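/- arXiv:1003.5060 — 6 statements merged into one kernel-verified Lean document; each statement's English description precedes it below -/
import Mathlib

section
/- Let G be a finite abelian group and f : G → ℂ a nonzero function. Then |supp(f)| · |supp(f̂)| ≥ |G|. -/
open Function

/-- The Fourier transform of `f : G → ℂ` on a finite abelian group `G`, as a function on the
dual group of characters: `f̂(χ) = ∑ x, f x * χ(-x)`. -/
noncomputable def dft (G : Type*) [AddCommGroup G] [Fintype G] (f : G → ℂ) :
    AddChar G ℂ → ℂ :=
  fun χ => ∑ x : G, f x * χ (-x)

/-- Fourier inversion for `dft`. -/
theorem sum_dft_mul_apply (G : Type*) [AddCommGroup G] [Fintype G] (f : G → ℂ) (a : G) :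
    ∑ χ : AddChar G ℂ, dft G f χ * χ a = Fintype.card G * f a := by
  classical
  simp only [dft, Finset.sum_mul, mul_assoc, ← AddChar.map_add_eq_mul]
  rw [Finset.sum_comm]
  simp [← Finset.mul_sum, AddChar.sum_apply_eq_ite, neg_add_eq_zero, mul_comm]

/-- A finite sum is bounded by the size of the support times a bound on the summands. -/
theorem sum_norm_le_ncard_support_mul {α : Type*} [Fintype α] (g : α → ℂ) {M : ℝ}
    (hM : ∀ a, ‖g a‖ ≤ M) : ∑ a, ‖g a‖ ≤ (support g).ncard * M := by
  classical
  have hcard : (support g).ncard = (Finset.univ.filter fun a => g a ≠ 0).card := by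
    rw [← Set.ncard_coe_finset]
    congr 1
    ext a
    simp
  have hsum : ∑ a ∈ Finset.univ.filter (fun a => g a ≠ 0), ‖g a‖ = ∑ a, ‖g a‖ :=
    Finset.sum_filter_of_ne fun a _ ha => norm_ne_zero_iff.mp ha
  rw [hcard, ← hsum, ← nsmul_eq_mul]
  exact Finset.sum_le_card_nsmul _ _ _ fun a _ => hM a

/-- **Donoho–Stark uncertainty principle**: for a nonzero function `f` on a finite abelian
group `G`, `|supp f| * |supp f̂| ≥ |G|`. -/
theorem donoho_stark_uncertainty (G : Type*) [AddCommGroup G] [Fintype G]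
    (f : G → ℂ) (hf : f ≠ 0) :
    Fintype.card G ≤ (support f).ncard * (support (dft G f)).ncard := by
  obtain ⟨a, ha⟩ := Finite.exists_max fun x => ‖f x‖
  have hpos : 0 < ‖f a‖ := by
    obtain ⟨b, hb⟩ := ne_iff.mp hf
    exact (norm_pos_iff.mpr hb).trans_le (ha b)
  have hdft (χ : AddChar G ℂ) : ‖dft G f χ‖ ≤ (support f).ncard * ‖f a‖ := by
    refine le_trans ?_ (sum_norm_le_ncard_support_mul f ha)
    exact (norm_sum_le _ _).trans_eq (by simp [AddChar.norm_apply])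
  have key : (Fintype.card G : ℝ) * ‖f a‖ ≤
      (support f).ncard * (support (dft G f)).ncard * ‖f a‖ := calc
    (Fintype.card G : ℝ) * ‖f a‖ = ‖∑ χ : AddChar G ℂ, dft G f χ * χ a‖ := by
      simp [sum_dft_mul_apply]
    _ ≤ ∑ χ : AddChar G ℂ, ‖dft G f χ‖ :=
      (norm_sum_le _ _).trans_eq (by simp [AddChar.norm_apply])
    _ ≤ (support (dft G f)).ncard * ((support f).ncard * ‖f a‖) :=
      sum_norm_le_ncard_support_mul _ hdft
    _ = (support f).ncard * (support (dft G f)).ncard * ‖f a‖ := by ring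
  exact_mod_cast le_of_mul_le_mul_right key hpos
end

section
/- Let p be a prime number and f : ℤ/pℤ → ℂ a nonzero function. Then |supp(f)| + |supp(f̂)| ≥ p + 1. -/
open Function

/-- The Fourier transform on `ℤ/nℤ`: `f̂(y) = ∑ x, f x * e^{-2πi x y / n}`. -/
noncomputable def zdft (n : ℕ) [NeZero n] (f : ZMod n → ℂ) : ZMod n → ℂ :=
  fun y => ∑ x : ZMod n,
    f x * Complex.exp (-2 * Real.pi * Complex.I * ((x.val * y.val : ℕ) : ℂ) / (n : ℂ))

open Polynomial in
/-- In characteristic `p`, a nonzero polynomial of degree less than `p` that vanishes to order `m`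
at `1` has more than `m` nonzero coefficients. -/
theorem Polynomial.lt_card_support_of_X_sub_one_pow_dvd {k : Type*} [Field k] (p : ℕ) [CharP k p]
    {m : ℕ} {q : k[X]} (hq : q ≠ 0) (hdeg : ∀ n ∈ q.support, n < p) (hdvd : (X - C 1) ^ m ∣ q) :
    m < q.support.card := by
  induction m generalizing q with
  | zero => simpa [Finset.card_pos] using hq
  | succ m ih =>
    obtain ⟨j, hj⟩ := Polynomial.nonempty_support_iff.2 hq
    set r : k[X] := X * derivative q - C (j : k) * q with hr
    have hcoeff (n : ℕ) : r.coeff n = ((n : k) - j) * q.coeff n := by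
      cases n with
      | zero => simp [hr]
      | succ n =>
        simp only [hr, coeff_sub, coeff_X_mul, coeff_derivative, coeff_C_mul]
        push_cast
        ring
    have hsub : r.support ⊆ q.support.erase j := by
      intro n hn
      rw [mem_support_iff, hcoeff] at hn
      rw [Finset.mem_erase, mem_support_iff]
      refine ⟨?_, right_ne_zero_of_mul hn⟩
      rintro rfl
      simp at hn
    have hr0 : r ≠ 0 := by
      intro h0
      have hmono : q = monomial j (q.coeff j) := by
        ext n
        rw [coeff_monomial]
        split_ifs with hjn
        · rw [hjn]
        · by_contra hn
          have h := hcoeff n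
          rw [h0, coeff_zero, eq_comm, mul_eq_zero, or_iff_left hn, sub_eq_zero] at h
          exact hjn ((CharP.natCast_injOn_Iio k p) (hdeg n (mem_support_iff.2 hn))
            (hdeg j hj) h).symm
      have hroot : q.eval 1 = 0 := by
        rw [← IsRoot.def, ← dvd_iff_isRoot]
        exact (dvd_pow_self _ m.succ_ne_zero).trans hdvd
      rw [hmono, eval_monomial, one_pow, mul_one] at hroot
      exact mem_support_iff.1 hj hroot
    have hrdvd : (X - C 1) ^ m ∣ r :=
      dvd_sub ((pow_sub_one_dvd_derivative_of_pow_dvd hdvd).mul_left _)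
        (((pow_dvd_pow _ m.le_succ).trans hdvd).mul_left _)
    have h1 := ih hr0 (fun n hn => hdeg n (Finset.mem_of_mem_erase (hsub hn))) hrdvd
    have h2 := Finset.card_le_card hsub
    have h3 := Finset.card_erase_add_one hj
    omega

/-- A field of characteristic zero has a valuation ring of every prime residue characteristic. -/
theorem ValuationSubring.exists_charP_residueField (K : Type*) [Field K] [CharZero K] (p : ℕ)
    [hp : Fact p.Prime] : ∃ V : ValuationSubring K, CharP (IsLocalRing.ResidueField V) p := by
  let A : Subring K := (Int.castRingHom K).range
  have hI : Ideal.span {(p : A)} ≠ ⊤ := by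
    rw [Ne, Ideal.span_singleton_eq_top]
    intro h
    obtain ⟨⟨_, n, rfl⟩, hn⟩ := h.exists_right_inv
    have hn' : (p : ℤ) * n = 1 := by
      have := congrArg Subtype.val hn
      simp at this
      exact_mod_cast this
    exact (Nat.prime_iff_prime_int.1 hp.out).not_isUnit (IsUnit.of_mul_eq_one _ hn')
  obtain ⟨V, -, hV⟩ := Ideal.image_subset_nonunits_valuationSubring _ hI
  have hpV : (p : K) ∈ V.nonunits :=
    hV ⟨(p : A), Ideal.mem_span_singleton_self _, by simp⟩
  refine ⟨V, (CharP.charP_iff_prime_eq_zero hp.out).2 ?_⟩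
  obtain ⟨h, hm⟩ := ValuationSubring.mem_nonunits_iff_exists_mem_maximalIdeal.1 hpV
  rw [← map_natCast (IsLocalRing.residue V), IsLocalRing.residue_eq_zero_iff]
  exact hm

/-- **Tao's uncertainty principle** on `ℤ/pℤ`, `p` prime: for a nonzero `f`,
`|supp f| + |supp f̂| ≥ p + 1`. -/
theorem tao_uncertainty (p : ℕ) [Fact p.Prime] (f : ZMod p → ℂ) (hf : f ≠ 0) :
    p + 1 ≤ (support f).ncard + (support (zdft p f)).ncard := by
  classical
  obtain ⟨V, hV⟩ := ValuationSubring.exists_charP_residueField ℂ p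
  have hp : p ≠ 0 := NeZero.ne p
  obtain ⟨ω, hω, hdft⟩ : ∃ ω : ℂ, IsPrimitiveRoot ω p ∧
      ∀ y, zdft p f y = ∑ x, f x * (ω ^ y.val) ^ x.val := by
    refine ⟨_, (Complex.isPrimitiveRoot_exp p hp).inv, fun y => ?_⟩
    refine Finset.sum_congr rfl fun x _ => ?_
    rw [← Complex.exp_neg, ← Complex.exp_nat_mul, ← Complex.exp_nat_mul]
    congr 2
    push_cast
    ring
  obtain ⟨x₀, hx₀⟩ := Finite.exists_max fun x => V.valuation (f x)
  have hfx₀ : f x₀ ≠ 0 := by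
    intro h
    refine hf (funext fun x => ?_)
    simpa [h] using hx₀ x
  have hωV : ω ∈ V := by
    rw [← V.valuation_le_one_iff]
    refine (pow_le_one_iff hp).1 ?_
    rw [← map_pow, hω.pow_eq_one, map_one]
  have hcV (x : ZMod p) : f x / f x₀ ∈ V := by
    rw [← V.valuation_le_one_iff, map_div₀]
    exact div_le_one_of_le₀ (hx₀ x) zero_le
  let w : V := ⟨ω, hωV⟩
  let c (x : ZMod p) : V := ⟨f x / f x₀, hcV x⟩
  let q : Polynomial V := ∑ x, Polynomial.monomial x.val (c x)
  have hcoeff (x : ZMod p) : q.coeff x.val = c x := by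
    simp [q, Polynomial.finsetSum_coeff, Polynomial.coeff_monomial, (ZMod.val_injective p).eq_iff]
  have hcoeff' (n : ℕ) (hn : q.coeff n ≠ 0) : ∃ x : ZMod p, x.val = n := by
    by_contra! h
    simp [q, Polynomial.finsetSum_coeff, Polynomial.coeff_monomial, h] at hn
  have hq0 : q ≠ 0 := by
    intro h
    have := hcoeff x₀
    simp [h, c, Subtype.ext_iff, hfx₀] at this
  have hw : IsLocalRing.residue V w = 1 := by
    have h : (IsLocalRing.residue V w - 1) ^ p = 0 := by
      have : w ^ p = 1 := Subtype.ext hω.pow_eq_one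
      rw [sub_pow_char, ← map_pow, this, map_one, one_pow, sub_self]
    exact sub_eq_zero.1 (eq_zero_of_pow_eq_zero h)
  let B : Finset (ZMod p) := Finset.univ.filter fun y => zdft p f y = 0
  have hdvd : ∏ y ∈ B, (Polynomial.X - Polynomial.C (w ^ y.val)) ∣ q := by
    have hinj : Set.InjOn (fun y : ZMod p => w ^ y.val) B := by
      intro y _ z _ hyz
      refine ZMod.val_injective p (hω.pow_inj (ZMod.val_lt y) (ZMod.val_lt z) ?_)
      exact congrArg Subtype.val hyz
    have hle : B.val.map (fun y => w ^ y.val) ≤ q.roots := by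
      rw [Multiset.le_iff_subset (Multiset.Nodup.map_on hinj B.nodup)]
      intro a ha
      obtain ⟨y, hy, rfl⟩ := Multiset.mem_map.1 ha
      rw [Polynomial.mem_roots hq0, Polynomial.IsRoot.def]
      refine Subtype.ext ?_
      have hy0 : ∑ x, f x * (ω ^ y.val) ^ x.val = 0 := by
        rw [← hdft]
        exact (Finset.mem_filter.1 hy).2
      simp [q, c, w, Polynomial.eval_finsetSum, div_mul_eq_mul_div, ← Finset.sum_div, hy0]
    simpa using (Multiset.prod_X_sub_C_dvd_iff_le_roots hq0 _).2 hle
  let r := q.map (IsLocalRing.residue V)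
  have hr0 : r ≠ 0 := by
    intro h
    have h1 : r.coeff x₀.val = 1 := by
      rw [Polynomial.coeff_map, hcoeff, ← map_one (IsLocalRing.residue V)]
      congr 1
      exact Subtype.ext (div_self hfx₀)
    simp [h] at h1
  have hsupp : r.support ⊆ ((support f).toFinset).image ZMod.val := by
    intro n hn
    rw [Polynomial.mem_support_iff, Polynomial.coeff_map] at hn
    have hqn : q.coeff n ≠ 0 := fun h => hn (by rw [h, map_zero])
    obtain ⟨x, rfl⟩ := hcoeff' n hqn
    refine Finset.mem_image_of_mem _ (Set.mem_toFinset.2 fun hx => hqn ?_)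
    rw [hcoeff]
    exact Subtype.ext (by simp [c, hx])
  have hrdvd : (Polynomial.X - Polynomial.C 1) ^ B.card ∣ r := by
    have := Polynomial.map_dvd (IsLocalRing.residue V) hdvd
    simpa [Polynomial.map_prod, hw] using this
  have hdeg (n : ℕ) (hn : n ∈ r.support) : n < p := by
    obtain ⟨x, -, rfl⟩ := Finset.mem_image.1 (hsupp hn)
    exact ZMod.val_lt x
  have hlt := (Polynomial.lt_card_support_of_X_sub_one_pow_dvd p hr0 hdeg hrdvd).trans_le
    ((Finset.card_le_card hsupp).trans Finset.card_image_le)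
  have hB : (support (zdft p f)).toFinset.card + B.card = p := by
    have hsplit := Finset.card_filter_add_card_filter_not (s := Finset.univ)
      (fun y => zdft p f y = 0)
    rw [Finset.card_univ, ZMod.card, add_comm] at hsplit
    convert hsplit using 3
    ext y
    simp
  rw [Set.ncard_eq_toFinset_card', Set.ncard_eq_toFinset_card']
  omega
end

section
/- Let p be a prime number, A ⊆ ℤ/pℤ and B ⊆ ℤ/pℤ subsets with |A| + |B| = p + s where s ≥ 0. Then the complex vector space of functions f : ℤ/pℤ → ℂ with supp(f) ⊆ A and supp(f̂) ⊆ B has dimension exactly s. -/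
open Function

lemma zdft_zero (n : ℕ) [NeZero n] : zdft n (0 : ZMod n → ℂ) = 0 := by
  funext y; simp [zdft]

lemma zdft_add (n : ℕ) [NeZero n] (f g : ZMod n → ℂ) :
    zdft n (f + g) = zdft n f + zdft n g := by
  funext y; simp [zdft, add_mul, Finset.sum_add_distrib]

lemma zdft_smul (n : ℕ) [NeZero n] (c : ℂ) (f : ZMod n → ℂ) :
    zdft n (c • f) = c • zdft n f := by
  funext y; simp [zdft, Finset.mul_sum, mul_assoc]

/-- For `A, B ⊆ ℤ/nℤ`, the space `E(A, B)` of functions with support in `A` and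
spectrum in `B`. -/
noncomputable def E (n : ℕ) [NeZero n] (A B : Set (ZMod n)) : Submodule ℂ (ZMod n → ℂ) where
  carrier := {f | support f ⊆ A ∧ support (zdft n f) ⊆ B}
  zero_mem' := ⟨by simp, by rw [zdft_zero]; simp⟩
  add_mem' := fun {f g} hf hg =>
    ⟨(support_add f g).trans (Set.union_subset hf.1 hg.1), by
      rw [zdft_add]
      exact (support_add _ _).trans (Set.union_subset hf.2 hg.2)⟩
  smul_mem' := fun c f hf =>
    ⟨(support_const_smul_subset c f).trans hf.1, by
      rw [zdft_smul]
      exact (support_const_smul_subset c _).trans hf.2⟩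

section Chebotarev

open Polynomial

lemma sum_mul_prod_sub_eq_zero {k : Type*} [CommRing k] (S T : Finset ℕ) (c : ℕ → k)
    (h : (X - 1 : k[X]) ^ (T.card + 1) ∣ ∑ j ∈ S, C (c j) * X ^ j) :
    ∑ j ∈ S, c j * ∏ t ∈ T, ((j : k) - t) = 0 := by
  induction T using Finset.induction_on generalizing c with
  | empty =>
    obtain ⟨q, hq⟩ := h
    simpa [eval_finsetSum] using congrArg (Polynomial.eval 1) hq
  | insert t T ht ih =>
    have key : (X - 1 : k[X]) ^ (T.card + 1) ∣
        ∑ j ∈ S, C (c j * ((j : k) - t)) * X ^ j := by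
      have e : ∑ j ∈ S, C (c j * ((j : k) - t)) * X ^ j =
          X * derivative (∑ j ∈ S, C (c j) * X ^ j) - C (t : k) * ∑ j ∈ S, C (c j) * X ^ j := by
        rw [derivative_sum, Finset.mul_sum, Finset.mul_sum, ← Finset.sum_sub_distrib]
        refine Finset.sum_congr rfl fun j _ => ?_
        rcases j with _ | j
        · simp
          ring
        · simp
          ring
      rw [e]
      rw [Finset.card_insert_of_notMem ht] at h
      refine dvd_sub (dvd_mul_of_dvd_right ?_ _)
        (dvd_mul_of_dvd_right ((pow_dvd_pow _ (by lia)).trans h) _)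
      simpa using pow_sub_one_dvd_derivative_of_pow_dvd h
    rw [← ih _ key]
    refine Finset.sum_congr rfl fun j _ => ?_
    rw [Finset.prod_insert ht, mul_assoc]

lemma coeff_eq_zero_of_X_sub_one_pow_dvd {p : ℕ} {k : Type*} [Field k] [CharP k p]
    (S : Finset ℕ) (hS : S ⊆ Finset.range p) (c : ℕ → k)
    (h : (X - 1 : k[X]) ^ S.card ∣ ∑ j ∈ S, C (c j) * X ^ j) {i : ℕ} (hi : i ∈ S) :
    c i = 0 := by
  have h0 := sum_mul_prod_sub_eq_zero S (S.erase i) c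
    (by rwa [Finset.card_erase_add_one hi])
  rw [Finset.sum_eq_single_of_mem i hi fun j hj hji => by
    rw [Finset.prod_eq_zero (Finset.mem_erase.2 ⟨hji, hj⟩) (sub_self _), mul_zero]] at h0
  refine (mul_eq_zero.1 h0).resolve_right (Finset.prod_ne_zero_iff.2 fun j hj => ?_)
  rw [Finset.mem_erase] at hj
  rw [sub_ne_zero]
  intro hij
  exact hj.1 (CharP.natCast_injOn_Iio k p (Finset.mem_range.1 (hS hj.2))
    (Finset.mem_range.1 (hS hi)) hij.symm)

lemma exists_valuationSubring_charP (K : Type*) [Field K] [CharZero K] (p : ℕ) [Fact p.Prime] :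
    ∃ V : ValuationSubring K, CharP (IsLocalRing.ResidueField V) p := by
  have hI : Ideal.span {(p : (Int.castRingHom K).range)} ≠ ⊤ := by
    rw [Ne, Ideal.span_singleton_eq_top]
    rintro hu
    obtain ⟨⟨_, n, rfl⟩, hn⟩ := hu.exists_right_inv
    have hn' : (p : K) * (n : K) = 1 := by simpa using congrArg Subtype.val hn
    have hn'' : (p : ℤ) * n = 1 := by exact_mod_cast hn'
    exact (Nat.prime_iff_prime_int.1 Fact.out : Prime (p : ℤ)).not_isUnit (.of_mul_eq_one _ hn'')
  obtain ⟨V, -, hV⟩ := Ideal.image_subset_nonunits_valuationSubring _ hI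
  refine ⟨V, ?_⟩
  have hp : (p : V) ∈ IsLocalRing.maximalIdeal V := by
    have := hV ⟨_, Ideal.subset_span rfl, rfl⟩
    obtain ⟨ha, hm⟩ := ValuationSubring.mem_nonunits_iff_exists_mem_maximalIdeal.1 this
    have hcast : (p : V) = ⟨_, ha⟩ := Subtype.ext
      ((map_natCast V.subtype p).trans (map_natCast (Int.castRingHom K).range.subtype p).symm)
    rwa [hcast]
  rw [CharP.charP_iff_prime_eq_zero Fact.out, ← map_natCast (IsLocalRing.residue V),
    IsLocalRing.residue_eq_zero_iff]
  exact hp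

/-- Chebotarev's theorem on minors of the Fourier matrix of prime order. -/
lemma IsPrimitiveRoot.eq_zero_of_sum_mul_pow_eq_zero {K : Type*} [Field K] [CharZero K] {p : ℕ}
    [Fact p.Prime] {ω : K} (hω : IsPrimitiveRoot ω p) (S T : Finset ℕ)
    (hS : S ⊆ Finset.range p) (hT : T ⊆ Finset.range p) (hST : S.card ≤ T.card) (c : ℕ → K)
    (h : ∀ t ∈ T, ∑ j ∈ S, c j * (ω ^ t) ^ j = 0) {i : ℕ} (hi : i ∈ S) : c i = 0 := by
  obtain ⟨V, hV⟩ := exists_valuationSubring_charP K p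
  obtain ⟨m, hm, hmax⟩ := S.exists_max_image (fun j => V.valuation (c j)) ⟨i, hi⟩
  by_contra hci
  have hcm : c m ≠ 0 := by
    intro h0
    have := hmax i hi
    rw [h0, map_zero, le_zero_iff, map_eq_zero] at this
    exact hci this
  have hd (j : ℕ) : ∃ d : V, j ∈ S → (d : K) = c j / c m := by
    by_cases hj : j ∈ S
    · refine ⟨⟨c j / c m, ?_⟩, fun _ => rfl⟩
      rw [← V.valuation_le_one_iff, map_div₀]
      exact div_le_one_of_le₀ (hmax j hj) zero_le
    · exact ⟨0, fun h => absurd h hj⟩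
  choose d hd using hd
  have hωV : ω ∈ V := by
    rw [← V.valuation_le_one_iff]
    refine (pow_le_one_iff (Fact.out : p.Prime).ne_zero).1 ?_
    rw [← map_pow, hω.pow_eq_one, map_one]
  obtain ⟨w, rfl⟩ : ∃ w : V, (w : K) = ω := ⟨⟨ω, hωV⟩, rfl⟩
  have hw : IsPrimitiveRoot w p :=
    IsPrimitiveRoot.of_map_of_injective (f := V.subtype) hω Subtype.val_injective
  have hdm : d m = 1 := Subtype.ext (by rw [hd m hm, div_self hcm]; rfl)
  have hres : IsLocalRing.residue V w = 1 := by
    refine frobenius_inj _ p ?_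
    rw [frobenius_def, ← map_pow, hw.pow_eq_one, map_one, map_one]
  set P : V[X] := ∑ j ∈ S, C (d j) * X ^ j with hPdef
  have hP : P ≠ 0 := by
    intro h0
    have := congrArg (coeff · m) h0
    simp [hPdef, coeff_C_mul, coeff_X_pow, hm, hdm] at this
  have hroot (t : ℕ) (ht : t ∈ T) : P.IsRoot (w ^ t) := by
    rw [IsRoot, hPdef]
    refine Subtype.ext ?_
    have : ∑ j ∈ S, c j / c m * ((w : K) ^ t) ^ j = 0 := by
      simp_rw [div_mul_eq_mul_div]
      rw [← Finset.sum_div, h t ht, zero_div]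
    simp only [eval_finsetSum, eval_mul, eval_C, eval_pow, eval_X]
    push_cast
    rw [← this]
    exact Finset.sum_congr rfl fun j hj => by rw [hd j hj]
  have hdvd : ∏ t ∈ T, (X - C (w ^ t)) ∣ P := by
    have hnd : (T.val.map fun t => w ^ t).Nodup :=
      Multiset.Nodup.map_on (fun a ha b hb hab => hw.pow_inj (Finset.mem_range.1 (hT ha))
        (Finset.mem_range.1 (hT hb)) hab) T.nodup
    have := (Multiset.prod_X_sub_C_dvd_iff_le_roots hP (T.val.map fun t => w ^ t)).2
      ((Multiset.le_iff_subset hnd).2 fun a ha => by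
        obtain ⟨t, ht, rfl⟩ := Multiset.mem_map.1 ha
        exact (mem_roots hP).2 (hroot t ht))
    rwa [Multiset.map_map] at this
  have hdvd' := Polynomial.map_dvd (IsLocalRing.residue V) hdvd
  rw [Polynomial.map_prod, hPdef, Polynomial.map_sum] at hdvd'
  simp only [Polynomial.map_sub, Polynomial.map_X, Polynomial.map_C, map_pow, hres, one_pow,
    Polynomial.map_mul, Polynomial.map_pow, map_one, Finset.prod_const] at hdvd'
  have := coeff_eq_zero_of_X_sub_one_pow_dvd S hS (fun j => IsLocalRing.residue V (d j))
    ((pow_dvd_pow _ hST).trans hdvd') hm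
  simp [hdm] at this

end Chebotarev

lemma zdft_eq_sum_pow (n : ℕ) [NeZero n] (f : ZMod n → ℂ) (y : ZMod n) :
    zdft n f y =
      ∑ x : ZMod n, f x * ((Complex.exp (2 * Real.pi * Complex.I / n))⁻¹ ^ y.val) ^ x.val := by
  refine Finset.sum_congr rfl fun x _ => ?_
  rw [← Complex.exp_neg, ← Complex.exp_nat_mul, ← Complex.exp_nat_mul]
  congr 2
  push_cast
  ring

/-- The uncertainty principle for `ℤ/pℤ`. -/
lemma eq_zero_of_card_le_of_zdft_eq_zero (p : ℕ) [Fact p.Prime] (S T : Finset (ZMod p))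
    (hST : S.card ≤ T.card) (f : ZMod p → ℂ) (hf : ∀ x ∉ S, f x = 0)
    (hT : ∀ y ∈ T, zdft p f y = 0) : f = 0 := by
  have hω := (Complex.isPrimitiveRoot_exp p (Fact.out : p.Prime).ne_zero).inv
  have hinj := ZMod.val_injective p
  funext x
  by_cases hx : x ∈ S
  · have hsub (U : Finset (ZMod p)) : U.image ZMod.val ⊆ Finset.range p := by
      intro j hj
      obtain ⟨u, -, rfl⟩ := Finset.mem_image.1 hj
      exact Finset.mem_range.2 u.val_lt
    have := hω.eq_zero_of_sum_mul_pow_eq_zero (S.image ZMod.val) (T.image ZMod.val)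
      (hsub S) (hsub T)
      (by rwa [Finset.card_image_of_injective _ hinj, Finset.card_image_of_injective _ hinj])
      (fun j => f (j : ZMod p))
      (fun t ht => by
        obtain ⟨y, hy, rfl⟩ := Finset.mem_image.1 ht
        rw [Finset.sum_image hinj.injOn, ← hT y hy, zdft_eq_sum_pow]
        simp only [ZMod.natCast_zmod_val]
        exact Finset.sum_subset (Finset.subset_univ _) fun x _ hx => by rw [hf x hx, zero_mul])
      (Finset.mem_image_of_mem _ hx)
    simpa using this
  · exact hf x hx

/-- The linear map sending `f` to its values off `A` and the values of its Fourier transform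
off `B`. -/
noncomputable def restrictCompl (n : ℕ) [NeZero n] (A B : Finset (ZMod n)) :
    (ZMod n → ℂ) →ₗ[ℂ] (↥Aᶜ → ℂ) × (↥Bᶜ → ℂ) where
  toFun f := (fun x => f x, fun y => zdft n f y)
  map_add' f g := by rw [zdft_add]; rfl
  map_smul' c f := by rw [zdft_smul]; rfl

lemma mem_E_iff (n : ℕ) [NeZero n] (A B : Finset (ZMod n)) (f : ZMod n → ℂ) :
    f ∈ E n A B ↔ (∀ x ∉ A, f x = 0) ∧ ∀ y ∉ B, zdft n f y = 0 := by
  change support f ⊆ _ ∧ support (zdft n f) ⊆ _ ↔ _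
  simp only [support_subset_iff', Finset.mem_coe]

lemma ker_restrictCompl (n : ℕ) [NeZero n] (A B : Finset (ZMod n)) :
    LinearMap.ker (restrictCompl n A B) = E n A B := by
  ext f
  rw [mem_E_iff]
  simp [restrictCompl, funext_iff]

lemma card_add_card_le_finrank_E (n : ℕ) [NeZero n] (A B : Finset (ZMod n)) :
    A.card + B.card ≤ n + Module.finrank ℂ (E n A B) := by
  have h1 := (restrictCompl n A B).finrank_range_add_finrank_ker
  have h2 := (LinearMap.range (restrictCompl n A B)).finrank_le
  have hA := A.card_compl_add_card
  have hB := B.card_compl_add_card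
  rw [ker_restrictCompl] at h1
  simp only [Module.finrank_prod, Module.finrank_fintype_fun_eq_card, Fintype.card_coe,
    ZMod.card] at h1 h2 hA hB
  lia

lemma finrank_E_le (p : ℕ) [Fact p.Prime] (s : ℕ) (A B : Finset (ZMod p))
    (h : A.card + B.card = p + s) : Module.finrank ℂ (E p A B) ≤ s := by
  have hB := B.card_compl_add_card
  rw [ZMod.card] at hB
  obtain ⟨A₁, hA₁, rfl⟩ := Finset.exists_subset_card_eq (show s ≤ A.card by lia)
  have hinj : Injective ((LinearMap.funLeft ℂ ℂ ((↑) : A₁ → ZMod p)).domRestrict (E p A B)) := by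
    rw [injective_iff_map_eq_zero]
    rintro ⟨f, hf⟩ hf0
    obtain ⟨hfA, hfB⟩ := (mem_E_iff p A B f).1 hf
    refine Subtype.ext (eq_zero_of_card_le_of_zdft_eq_zero p (A \ A₁) Bᶜ ?_ f ?_ ?_)
    · rw [Finset.card_sdiff_of_subset hA₁]
      lia
    · intro x hx
      by_cases hx₁ : x ∈ A₁
      · exact congrFun hf0 ⟨x, hx₁⟩
      · exact hfA x fun hxA => hx (Finset.mem_sdiff.2 ⟨hxA, hx₁⟩)
    · exact fun y hy => hfB y (Finset.mem_compl.1 hy)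
  simpa using LinearMap.finrank_le_finrank_of_injective hinj

/-- On `ℤ/pℤ`, `p` prime, if `|A| + |B| = p + s` then the space of functions with support in
`A` and spectrum in `B` has dimension exactly `s`. -/
theorem dim_eq (p : ℕ) [Fact p.Prime] (s : ℕ) (A B : Set (ZMod p))
    (h : A.ncard + B.ncard = p + s) :
    Module.finrank ℂ (E p A B) = s := by
  classical
  obtain ⟨A, rfl⟩ := A.toFinite.exists_finset_coe
  obtain ⟨B, rfl⟩ := B.toFinite.exists_finset_coe
  rw [Set.ncard_coe_finset, Set.ncard_coe_finset] at h
  have := card_add_card_le_finrank_E p A B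
  exact le_antisymm (finrank_E_le p s A B h) (by lia)
end

section
/- Let G be a finite abelian group and 2 ≤ k ≤ |G|. If θ(k, G) < θ(k-1, G), then θ(θ(k, G), Ĝ) = k. -/
open Function

/-- Meshulam's function `θ(k, G)`: the minimal size of the spectrum of a nonzero function
on `G` whose support has size at most `k`. -/
noncomputable def theta (G : Type*) [AddCommGroup G] [Fintype G] (k : ℕ) : ℕ :=
  sInf {l | ∃ f : G → ℂ, f ≠ 0 ∧ (support f).ncard ≤ k ∧ (support (dft G f)).ncard = l}

/-- The Fourier transform of a function on the dual group `Ĝ`, as a function on `G`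
(identifying the dual of `Ĝ` with `G`): `ĝ(x) = ∑ χ, g χ * χ(-x)`. -/
noncomputable def dualDft (G : Type*) [AddCommGroup G] [Fintype G]
    (g : AddChar G ℂ → ℂ) : G → ℂ :=
  fun x => ∑ χ : AddChar G ℂ, g χ * χ (-x)

/-- Meshulam's function `θ(·, Ĝ)` for the dual group `Ĝ` of `G`. -/
noncomputable def dualTheta (G : Type*) [AddCommGroup G] [Fintype G] (l : ℕ) : ℕ :=
  sInf {m | ∃ g : AddChar G ℂ → ℂ,
    g ≠ 0 ∧ (support g).ncard ≤ l ∧ (support (dualDft G g)).ncard = m}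

/-- Fourier inversion on `G`: transforming twice gives the reflected function, up to `|G|`. -/
theorem dualDft_dft (G : Type*) [AddCommGroup G] [Fintype G] (f : G → ℂ) (x : G) :
    dualDft G (dft G f) x = Fintype.card G * f (-x) := by
  classical
  have key (y : G) : ∑ χ : AddChar G ℂ, χ (-y) * χ (-x) =
      if y = -x then (Fintype.card G : ℂ) else 0 := by
    simp_rw [← AddChar.map_add_eq_mul]
    rw [AddChar.sum_apply_eq_ite]
    refine if_congr ?_ rfl rfl
    rw [← neg_add, neg_eq_zero, add_eq_zero_iff_eq_neg]
  simp only [dualDft, dft, Finset.sum_mul]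
  rw [Finset.sum_comm]
  simp_rw [mul_assoc, ← Finset.mul_sum, key]
  simp [mul_comm]

/-- Fourier inversion on the dual group of `G`. -/
theorem dft_dualDft (G : Type*) [AddCommGroup G] [Fintype G] (g : AddChar G ℂ → ℂ)
    (χ : AddChar G ℂ) :
    dft G (dualDft G g) χ = Fintype.card G * g χ⁻¹ := by
  classical
  have key (ψ : AddChar G ℂ) : ∑ x : G, ψ (-x) * χ (-x) =
      if ψ = χ⁻¹ then (Fintype.card G : ℂ) else 0 := by
    refine (Equiv.sum_comp (Equiv.neg G) fun x => ψ x * χ x).trans ?_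
    simp_rw [← AddChar.mul_apply]
    rw [AddChar.sum_eq_ite]
    refine if_congr ?_ rfl rfl
    rw [← AddChar.one_eq_zero, mul_eq_one_iff_eq_inv]
  simp only [dualDft, dft, Finset.sum_mul]
  rw [Finset.sum_comm]
  simp_rw [mul_assoc, ← Finset.mul_sum, key]
  simp [mul_comm]

/-- The double transform of `f` has as many nonzero values as `f`. -/
theorem ncard_support_dualDft_dft (G : Type*) [AddCommGroup G] [Fintype G] (f : G → ℂ) :
    (support (dualDft G (dft G f))).ncard = (support f).ncard := by
  have hs : support (dualDft G (dft G f)) = Neg.neg ⁻¹' support f := by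
    ext x
    simp [dualDft_dft]
  rw [hs]
  exact Set.ncard_preimage_of_injective_subset_range neg_injective
    (by simp [neg_surjective.range_eq])

/-- The double transform of `g` has as many nonzero values as `g`. -/
theorem ncard_support_dft_dualDft (G : Type*) [AddCommGroup G] [Fintype G]
    (g : AddChar G ℂ → ℂ) :
    (support (dft G (dualDft G g))).ncard = (support g).ncard := by
  have hs : support (dft G (dualDft G g)) = Inv.inv ⁻¹' support g := by
    ext χ
    simp [dft_dualDft]
  rw [hs]
  exact Set.ncard_preimage_of_injective_subset_range inv_injective
    (by simp [inv_surjective.range_eq])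

theorem dft_ne_zero {G : Type*} [AddCommGroup G] [Fintype G] {f : G → ℂ} (hf : f ≠ 0) :
    dft G f ≠ 0 := by
  intro h0
  have hs := ncard_support_dualDft_dft G f
  have hz : dualDft G (0 : AddChar G ℂ → ℂ) = 0 := by ext; simp [dualDft]
  rw [h0, hz, support_zero, Set.ncard_empty, eq_comm, Set.ncard_eq_zero] at hs
  exact hf (support_eq_empty_iff.mp hs)

theorem dualDft_ne_zero {G : Type*} [AddCommGroup G] [Fintype G] {g : AddChar G ℂ → ℂ}
    (hg : g ≠ 0) : dualDft G g ≠ 0 := by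
  intro h0
  have hs := ncard_support_dft_dualDft G g
  have hz : dft G (0 : G → ℂ) = 0 := by ext; simp [dft]
  rw [h0, hz, support_zero, Set.ncard_empty, eq_comm, Set.ncard_eq_zero] at hs
  exact hg (support_eq_empty_iff.mp hs)

/-- For `k ≥ 1` the minimum defining `θ(k, G)` is attained. -/
theorem exists_ncard_support_dft_eq_theta (G : Type*) [AddCommGroup G] [Fintype G] {k : ℕ}
    (hk : 1 ≤ k) :
    ∃ f : G → ℂ, f ≠ 0 ∧ (support f).ncard ≤ k ∧ (support (dft G f)).ncard = theta G k := by
  classical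
  refine Nat.sInf_mem (s := {l | ∃ f : G → ℂ, f ≠ 0 ∧ (support f).ncard ≤ k ∧
    (support (dft G f)).ncard = l}) ⟨_, Pi.single 0 1, by simp, ?_, rfl⟩
  rw [Pi.support_single_of_ne one_ne_zero, Set.ncard_singleton]
  exact hk

/-- If `θ(k, G) < θ(k - 1, G)` then `θ(θ(k, G), Ĝ) = k`. -/
theorem dualTheta_theta (G : Type*) [AddCommGroup G] [Fintype G] (k : ℕ)
    (hk1 : 2 ≤ k) (hk2 : k ≤ Fintype.card G)
    (h : theta G k < theta G (k - 1)) :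
    dualTheta G (theta G k) = k := by
  obtain ⟨f, hf, hfk, hfl⟩ := exists_ncard_support_dft_eq_theta G (one_le_two.trans hk1)
  have hmem : (support f).ncard ∈ {m | ∃ g : AddChar G ℂ → ℂ,
      g ≠ 0 ∧ (support g).ncard ≤ theta G k ∧ (support (dualDft G g)).ncard = m} :=
    ⟨dft G f, dft_ne_zero hf, hfl.le, ncard_support_dualDft_dft G f⟩
  refine le_antisymm ((Nat.sInf_le hmem).trans hfk) (le_csInf ⟨_, hmem⟩ ?_)
  rintro m ⟨g, hg, hgl, rfl⟩
  by_contra! hlt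
  have hle : theta G (k - 1) ≤ (support g).ncard :=
    Nat.sInf_le ⟨dualDft G g, dualDft_ne_zero hg, Nat.le_sub_one_of_lt hlt,
      ncard_support_dft_dualDft G g⟩
  exact (hle.trans hgl).not_gt h
end

section
/- Let p and q be prime numbers with 1 < q < p and let G = ℤ/qℤ × ℤ/pℤ. Then: θ(k, G) = p(q - k + 1) for 1 ≤ k ≤ q; θ(k, G) = p - ⌊k/q⌋ + 1 for q ≤ k ≤ q(p+1)/(q+1); θ(k, G) = q(p - k + 1) for q(p+1)/(q+1) ≤ k ≤ p; and θ(k, G) = q - ⌊k/p⌋ + 1 for p ≤ k ≤ pq. -/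
open Function

open Polynomial in
/-- In characteristic `p`, a nonzero polynomial of degree less than `p` divisible by `(X - 1) ^ n`
has more than `n` nonzero coefficients. -/
lemma lt_card_support_of_X_sub_one_pow_dvd {k : Type*} [Field k] {p : ℕ} [CharP k p] (n : ℕ) :
    ∀ g : k[X], g ≠ 0 → g.natDegree < p → (X - 1) ^ n ∣ g → n < g.support.card := by
  induction n with
  | zero =>
    intro g hg _ _
    exact Finset.card_pos.2 (nonempty_support_iff.2 hg)
  | succ n ih =>
    intro g hg hdeg hdvd
    obtain ⟨c, hc⟩ := nonempty_support_iff.2 hg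
    set d : k[X] := X * derivative g - C (c : k) * g with hd
    have hcoeff (m : ℕ) : d.coeff m = ((m : k) - c) * g.coeff m := by
      rw [hd, coeff_sub, coeff_C_mul]
      cases m with
      | zero => simp
      | succ m => rw [coeff_X_mul, coeff_derivative]; push_cast; ring
    have hcast (m : ℕ) (hm : m ∈ g.support) (h : (m : k) = c) : m = c := by
      have h1 := (CharP.natCast_eq_natCast k p).1 h
      exact Nat.ModEq.eq_of_lt_of_lt h1 ((le_natDegree_of_mem_supp _ hm).trans_lt hdeg)
        ((le_natDegree_of_mem_supp _ hc).trans_lt hdeg)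
    have hsupp : d.support = g.support.erase c := by
      ext m
      rw [Finset.mem_erase, mem_support_iff, hcoeff]
      constructor
      · intro h
        exact ⟨fun e => h (by simp [e]), mem_support_iff.2 (right_ne_zero_of_mul h)⟩
      · rintro ⟨h1, h2⟩
        exact mul_ne_zero (fun h => h1 (hcast m h2 (sub_eq_zero.1 h))) (mem_support_iff.1 h2)
    have hcard : d.support.card + 1 = g.support.card := by
      rw [hsupp, Finset.card_erase_add_one hc]
    have hddvd : (X - 1) ^ n ∣ d := by
      refine dvd_sub (Dvd.dvd.mul_left ?_ _)
        (Dvd.dvd.mul_left ((pow_dvd_pow _ n.le_succ).trans hdvd) _)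
      obtain ⟨h, rfl⟩ := hdvd
      rw [derivative_mul, derivative_pow]
      refine dvd_add ?_ ?_
      · simp only [Nat.add_sub_cancel]
        exact Dvd.dvd.mul_right (Dvd.dvd.mul_right (Dvd.dvd.mul_left dvd_rfl _) _) _
      · exact Dvd.dvd.mul_right (pow_dvd_pow _ n.le_succ) _
    have hd0 : d ≠ 0 := by
      intro h0
      have h1 : g.support.card = 1 := by rw [← hcard, h0]; simp
      obtain ⟨i, a, ha, rfl⟩ := card_support_eq_one.1 h1
      have := eval_dvd (x := 1) ((dvd_pow_self _ n.succ_ne_zero).trans hdvd)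
      simp at this
      exact ha this
    have hddeg : d.natDegree < p := by
      refine (natDegree_lt_iff_degree_lt hd0).2 ((degree_lt_iff_coeff_zero _ _).2 fun m hm => ?_)
      rw [hcoeff, coeff_eq_zero_of_natDegree_lt (hdeg.trans_le hm), mul_zero]
    have := ih d hd0 hddeg hddvd
    omega

/-- There is a valuation subring of `ℂ` in which the prime `p` is not a unit. -/
lemma exists_valuationSubring_natCast_mem_nonunits (p : ℕ) [Fact p.Prime] :
    ∃ V : ValuationSubring ℂ, (p : ℂ) ∈ V.nonunits := by
  let A : Subring ℂ := (Int.castRingHom ℂ).range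
  have hI : Ideal.span {(p : A)} ≠ ⊤ := by
    rw [Ne, Ideal.span_singleton_eq_top, isUnit_iff_exists_inv]
    rintro ⟨⟨_, n, rfl⟩, h⟩
    have h2 : (p : ℂ) * ((n : ℤ) : ℂ) = 1 := by simpa using congrArg (Subtype.val) h
    have h3 : (p : ℤ) * n = 1 := by exact_mod_cast h2
    have h4 : (p : ℤ) ∣ 1 := ⟨n, h3.symm⟩
    have := Int.natCast_dvd_natCast.1 (by simpa using h4 : (p : ℤ) ∣ ((1 : ℕ) : ℤ))
    exact (Fact.out : p.Prime).one_lt.ne' (Nat.dvd_one.1 this)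
  obtain ⟨V, -, hV⟩ := Ideal.image_subset_nonunits_valuationSubring _ hI
  exact ⟨V, hV ⟨(p : A), Ideal.subset_span rfl, by simp⟩⟩

open Polynomial in
/-- A nonzero complex polynomial of degree less than a prime `p` that vanishes at `n` distinct
`p`-th roots of unity has more than `n` nonzero coefficients. -/
lemma card_lt_card_support_of_roots_of_unity {p : ℕ} [Fact p.Prime] {g : ℂ[X]} (hg : g ≠ 0)
    (hdeg : g.natDegree < p) (S : Finset ℂ) (hS : ∀ z ∈ S, z ^ p = 1)
    (hgS : ∀ z ∈ S, g.eval z = 0) : S.card < g.support.card := by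
  have hp : p.Prime := Fact.out
  obtain ⟨V, hV⟩ := exists_valuationSubring_natCast_mem_nonunits p
  obtain ⟨c, hc, hmax⟩ := g.support.exists_max_image (fun i => V.valuation (g.coeff i))
    (nonempty_support_iff.2 hg)
  have hc0 : g.coeff c ≠ 0 := mem_support_iff.1 hc
  set h : ℂ[X] := C (g.coeff c)⁻¹ * g with hh
  have hcoeff (i : ℕ) : h.coeff i ∈ V := by
    rw [hh, coeff_C_mul, ← V.valuation_le_one_iff, map_mul, map_inv₀]
    by_cases hi : i ∈ g.support
    · exact inv_mul_le_one_of_le₀ (hmax i hi) zero_le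
    · simp [notMem_support_iff.1 hi]
  have hlift : h ∈ lifts V.subtype := by
    rw [lifts_iff_coeff_lifts]
    intro i
    exact ⟨⟨_, hcoeff i⟩, rfl⟩
  obtain ⟨G, hG⟩ := hlift
  replace hG : G.map V.subtype = h := hG
  have hGcoeff (i : ℕ) : (G.coeff i : ℂ) = (g.coeff c)⁻¹ * g.coeff i := by
    have := congrArg (fun f => coeff f i) hG
    simpa [hh] using this
  let k := IsLocalRing.ResidueField V
  let π : V →+* k := IsLocalRing.residue V
  have hpk : (p : k) = 0 := by
    have : π (p : V) = 0 := by
      rw [IsLocalRing.residue_eq_zero_iff]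
      have := (V.mem_nonunits_iff_exists_mem_maximalIdeal).1 hV
      obtain ⟨h1, h2⟩ := this
      exact h2
    simpa using this
  have : CharP k p := (CharP.charP_iff_prime_eq_zero hp).2 hpk
  have hG1 : G.map π ≠ 0 := by
    intro h0
    have h1 := congrArg (fun f => coeff f c) h0
    have h2 : G.coeff c = 1 := Subtype.ext (by rw [hGcoeff, inv_mul_cancel₀ hc0]; rfl)
    simp [h2] at h1
  have hG0 : G ≠ 0 := by rintro rfl; simp at hG1
  have hsub : (G.map π).support ⊆ g.support := by
    intro i hi
    rw [mem_support_iff] at hi ⊢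
    contrapose! hi
    have : G.coeff i = 0 := Subtype.ext (by rw [hGcoeff, hi, mul_zero]; rfl)
    rw [coeff_map, this, map_zero]
  have hmem (z : ℂ) (hz : z ∈ S) : z ∈ V := by
    rw [← V.valuation_le_one_iff]
    have : V.valuation z ^ p = 1 := by rw [← map_pow, hS z hz, map_one]
    exact (pow_eq_one_iff_of_nonneg zero_le hp.ne_zero).1 this |>.le
  let T : Finset V := S.attach.image fun z => ⟨z.1, hmem z.1 z.2⟩
  have hTcard : T.card = S.card := by
    rw [Finset.card_image_of_injective, Finset.card_attach]
    intro a b hab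
    exact Subtype.ext (by simpa only [Subtype.mk.injEq] using hab)
  have hTS (t : V) (ht : t ∈ T) : (t : ℂ) ∈ S := by
    obtain ⟨z, -, rfl⟩ := Finset.mem_image.1 ht
    exact z.2
  have hroots : T.val ≤ G.roots := by
    rw [Multiset.le_iff_subset T.nodup]
    intro t ht
    rw [mem_roots hG0, IsRoot.def]
    refine Subtype.ext ?_
    have h1 : (G.map V.subtype).eval (V.subtype t) = 0 := by
      rw [hG, hh, eval_mul]
      rw [show V.subtype t = (t : ℂ) from rfl, hgS _ (hTS t ht), mul_zero]
    rw [eval_map_apply] at h1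
    exact h1
  have hdvd := (Multiset.prod_X_sub_C_dvd_iff_le_roots hG0 T.val).2 hroots
  have hπT (t : V) (ht : t ∈ T) : π t = 1 := by
    have h1 : t ^ p = 1 := Subtype.ext (hS _ (hTS t ht))
    have h2 : (π t - 1) ^ p = 0 := by
      have : Fact p.Prime := ⟨hp⟩
      rw [sub_pow_char, ← map_pow, h1, map_one, one_pow, sub_self]
    exact sub_eq_zero.1 (pow_eq_zero_iff hp.ne_zero |>.1 h2)
  have hdvd2 : (X - 1) ^ S.card ∣ G.map π := by
    have h1 := map_dvd π hdvd
    change _ ∣ G.map π at h1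
    convert h1
    rw [← hTcard]
    change _ = Polynomial.map π (∏ t ∈ T, (X - C t))
    rw [Polynomial.map_prod, Finset.prod_congr rfl (g := fun _ => X - 1), Finset.prod_const]
    intro t ht
    simp [hπT t ht]
  have hdeg2 : (G.map π).natDegree < p :=
    (natDegree_lt_iff_degree_lt hG1).2 ((degree_lt_iff_coeff_zero _ _).2 fun m hm => by
      by_contra hne
      have := le_natDegree_of_mem_supp _ (hsub (mem_support_iff.2 hne))
      omega)
  exact (lt_card_support_of_X_sub_one_pow_dvd _ _ hG1 hdeg2 hdvd2).trans_le
    (Finset.card_le_card hsub)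

/-- Uncertainty principle for `ℤ/pℤ`, `p` prime. -/
lemma card_support_add_card_support_dft_ge {p : ℕ} [Fact p.Prime] {f : ZMod p → ℂ} (hf : f ≠ 0) :
    p + 1 ≤ (support f).ncard + (support (dft _ f)).ncard := by
  classical
  have hp : p.Prime := Fact.out
  have : NeZero p := ⟨hp.ne_zero⟩
  let g : Polynomial ℂ := ∑ x : ZMod p, Polynomial.monomial x.val (f x)
  have hcoeff (y : ZMod p) : g.coeff y.val = f y := by
    simp only [g, Polynomial.finsetSum_coeff, Polynomial.coeff_monomial]
    rw [Finset.sum_eq_single y]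
    · simp
    · intro b _ hb
      exact if_neg fun h => hb (ZMod.val_injective p h)
    · simp
  have hcoeff' (m : ℕ) (hm : g.coeff m ≠ 0) : ∃ x : ZMod p, x.val = m := by
    simp only [g, Polynomial.finsetSum_coeff, Polynomial.coeff_monomial] at hm
    obtain ⟨x, -, hx⟩ := Finset.exists_ne_zero_of_sum_ne_zero hm
    exact ⟨x, by by_contra h; simp [h] at hx⟩
  have hg : g ≠ 0 := by
    intro h
    refine hf (funext fun y => ?_)
    rw [← hcoeff, h]; simp
  have hdeg : g.natDegree < p := by
    obtain ⟨x, hx⟩ := hcoeff' g.natDegree (Polynomial.leadingCoeff_ne_zero.2 hg)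
    exact hx ▸ x.val_lt
  have hsupp : g.support.card ≤ (support f).ncard := by
    rw [Set.ncard_eq_toFinset_card']
    refine (Finset.card_le_card (t := (support f).toFinset.image ZMod.val) fun m hm => ?_).trans
      Finset.card_image_le
    have hm' := Polynomial.mem_support_iff.1 hm
    obtain ⟨x, rfl⟩ := hcoeff' m hm'
    refine Finset.mem_image_of_mem _ ?_
    rw [Set.mem_toFinset, mem_support, ← hcoeff]
    exact hm'
  have heval (χ : AddChar (ZMod p) ℂ) : g.eval (χ (-1)) = dft _ f χ := by
    simp only [g, Polynomial.eval_finsetSum, Polynomial.eval_monomial, dft]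
    refine Finset.sum_congr rfl fun x _ => ?_
    rw [← AddChar.map_nsmul_eq_pow]
    simp
  have hinj : Injective fun χ : AddChar (ZMod p) ℂ => χ (-1) := by
    intro χ ψ h
    ext x
    have hx : x = (-x).val • (-1 : ZMod p) := by simp
    rw [hx, AddChar.map_nsmul_eq_pow, AddChar.map_nsmul_eq_pow]
    exact congrArg (· ^ _) h
  let Z : Finset (AddChar (ZMod p) ℂ) := {χ | dft _ f χ = 0}
  have hlt := card_lt_card_support_of_roots_of_unity hg hdeg (Z.image fun χ => χ (-1))
    (by
      intro z hz
      obtain ⟨χ, -, rfl⟩ := Finset.mem_image.1 hz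
      rw [← AddChar.map_nsmul_eq_pow]
      simp)
    (by
      intro z hz
      obtain ⟨χ, hχ, rfl⟩ := Finset.mem_image.1 hz
      rw [heval]
      exact (Finset.mem_filter.1 hχ).2)
  rw [Finset.card_image_of_injective _ hinj] at hlt
  have hcard : Z.card + (support (dft _ f)).ncard = p := by
    have h1 := Finset.card_filter_add_card_filter_not (s := Finset.univ)
      (fun χ : AddChar (ZMod p) ℂ => dft _ f χ = 0)
    rw [Finset.card_univ, AddChar.card_eq, ZMod.card] at h1
    rw [Set.ncard_eq_toFinset_card']
    refine Eq.trans ?_ h1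
    congr 2
    ext χ
    simp
  omega

/-- On any finite abelian group there is a nonzero function supported on at most `k` points whose
spectrum misses at least `k - 1` characters. -/
lemma exists_card_support_le_card_support_dft_le {G : Type*} [AddCommGroup G] [Fintype G] {k : ℕ}
    (hk : 1 ≤ k) (hkG : k ≤ Fintype.card G) :
    ∃ f : G → ℂ, f ≠ 0 ∧ (support f).ncard ≤ k ∧
      (support (dft G f)).ncard ≤ Fintype.card G - k + 1 := by
  classical
  obtain ⟨A, -, hA⟩ := Finset.exists_subset_card_eq (s := (Finset.univ : Finset G)) (n := k)
    (by simpa using hkG)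
  obtain ⟨B, -, hB⟩ := Finset.exists_subset_card_eq
    (s := (Finset.univ : Finset (AddChar G ℂ))) (n := k - 1)
    (by rw [Finset.card_univ, AddChar.card_eq]; omega)
  let L : (A → ℂ) →ₗ[ℂ] (B → ℂ) :=
    (Matrix.of fun (χ : B) (x : A) => χ.1 (-x.1)).mulVecLin
  have hker : LinearMap.ker L ≠ ⊥ := L.ker_ne_bot_of_finrank_lt (by simp [hA, hB]; omega)
  obtain ⟨v, hv, hv0⟩ := (Submodule.ne_bot_iff _).1 hker
  let f : G → ℂ := fun x => if h : x ∈ A then v ⟨x, h⟩ else 0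
  have hfv (x : A) : f x = v x := by simp [f]
  have hdft (χ : AddChar G ℂ) (hχ : χ ∈ B) : dft G f χ = 0 := by
    have h1 : L v ⟨χ, hχ⟩ = 0 := by rw [LinearMap.mem_ker.1 hv]; rfl
    rw [← h1]
    simp only [dft, L, Matrix.mulVecLin_apply, Matrix.mulVec, dotProduct, Matrix.of_apply]
    rw [← Finset.sum_subset (Finset.subset_univ A), ← Finset.sum_coe_sort A]
    · exact Finset.sum_congr rfl fun x _ => by rw [hfv, mul_comm]
    · intro x _ hx
      simp [f, hx]
  refine ⟨f, ?_, ?_, ?_⟩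
  · rintro h
    refine hv0 (funext fun x => ?_)
    rw [← hfv, h]; rfl
  · rw [← hA, ← Set.ncard_coe_finset]
    refine Set.ncard_le_ncard (fun x hx => ?_) (Finset.finite_toSet _)
    by_contra h
    exact hx (dif_neg h)
  · have h1 : (support (dft G f)).ncard ≤ (Bᶜ).card := by
      rw [← Set.ncard_coe_finset]
      refine Set.ncard_le_ncard (fun χ hχ => ?_) (Finset.finite_toSet _)
      rw [Finset.mem_coe, Finset.mem_compl]
      exact fun h => hχ (hdft χ h)
    rw [Finset.card_compl, AddChar.card_eq, hB] at h1
    omega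

section Product

variable {G H : Type*} [AddCommGroup G] [AddCommGroup H]

/-- The character `(x, y) ↦ χ x * ψ y` of a product group. -/
noncomputable def AddChar.prodMk (χ : AddChar G ℂ) (ψ : AddChar H ℂ) : AddChar (G × H) ℂ :=
  χ.compAddMonoidHom (AddMonoidHom.fst G H) * ψ.compAddMonoidHom (AddMonoidHom.snd G H)

lemma AddChar.prodMk_apply (χ : AddChar G ℂ) (ψ : AddChar H ℂ) (z : G × H) :
    χ.prodMk ψ z = χ z.1 * ψ z.2 := rfl

/-- The characters of a product group are the pairs of characters of its factors. -/
noncomputable def AddChar.prodEquiv : AddChar G ℂ × AddChar H ℂ ≃ AddChar (G × H) ℂ where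
  toFun z := z.1.prodMk z.2
  invFun χ := (χ.compAddMonoidHom (AddMonoidHom.inl G H), χ.compAddMonoidHom (AddMonoidHom.inr G H))
  left_inv z := by
    ext x <;> simp [AddChar.prodMk_apply]
  right_inv χ := by
    ext x
    simp [AddChar.prodMk_apply, ← AddChar.map_add_eq_mul]

variable [Fintype G] [Fintype H]

lemma dft_prodMk (F : G × H → ℂ) (χ : AddChar G ℂ) (ψ : AddChar H ℂ) :
    dft (G × H) F (χ.prodMk ψ) = dft G (fun x => dft H (fun y => F (x, y)) ψ) χ := by
  simp only [dft, Fintype.sum_prod_type, AddChar.prodMk_apply, Finset.sum_mul]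
  refine Finset.sum_congr rfl fun x _ => Finset.sum_congr rfl fun y _ => ?_
  simp only [Prod.fst_neg, Prod.snd_neg]
  ring

lemma dft_mul_prodMk (f : G → ℂ) (g : H → ℂ) (χ : AddChar G ℂ) (ψ : AddChar H ℂ) :
    dft (G × H) (fun z => f z.1 * g z.2) (χ.prodMk ψ) = dft G f χ * dft H g ψ := by
  rw [dft_prodMk]
  simp only [dft]
  rw [Finset.sum_mul_sum]
  refine Finset.sum_congr rfl fun x _ => ?_
  rw [Finset.sum_mul]
  refine Finset.sum_congr rfl fun y _ => ?_
  ring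

lemma ncard_support_dft_mul (f : G → ℂ) (g : H → ℂ) :
    (support (dft (G × H) fun z => f z.1 * g z.2)).ncard =
      (support (dft G f)).ncard * (support (dft H g)).ncard := by
  rw [← Set.ncard_prod,
    ← Set.ncard_image_of_injective _ (AddChar.prodEquiv (G := G) (H := H)).injective]
  congr 1
  ext χ
  obtain ⟨⟨χ, ψ⟩, rfl⟩ := AddChar.prodEquiv.surjective χ
  rw [AddChar.prodEquiv.injective.mem_set_image]
  change dft _ _ (χ.prodMk ψ) ≠ 0 ↔ _
  rw [dft_mul_prodMk, mul_ne_zero_iff]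
  rfl

/-- The spectrum of a nonzero function `F` on a product group is at least the product of lower bounds
for the spectra on the factors, at support sizes `s` and `t` with `s * t` at most the size of the
support of `F`. -/
lemma exists_mul_le_ncard_support_dft {F : G × H → ℂ} (hF : F ≠ 0) {a : ℕ → ℕ} {b : ℕ → ℕ}
    (ha : Antitone a)
    (haG : ∀ f : G → ℂ, f ≠ 0 → a (support f).ncard ≤ (support (dft G f)).ncard)
    (hbH : ∀ g : H → ℂ, g ≠ 0 → b (support g).ncard ≤ (support (dft H g)).ncard) :
    ∃ s t : ℕ, 1 ≤ s ∧ s ≤ Fintype.card G ∧ 1 ≤ t ∧ t ≤ Fintype.card H ∧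
      s * t ≤ (support F).ncard ∧ a s * b t ≤ (support (dft (G × H) F)).ncard := by
  classical
  let T : Finset G := {x | (fun y => F (x, y)) ≠ 0}
  have hTne : T.Nonempty := by
    obtain ⟨⟨x, y⟩, hz⟩ := ne_iff.1 hF
    exact ⟨x, Finset.mem_filter.2 ⟨Finset.mem_univ _, fun h => hz (congrFun h y)⟩⟩
  obtain ⟨x₀, hx₀, hmin⟩ := T.exists_min_image (fun x => (support fun y => F (x, y)).ncard) hTne
  have hx₀F : (fun y => F (x₀, y)) ≠ 0 := (Finset.mem_filter.1 hx₀).2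
  let W : Finset (AddChar H ℂ) := {ψ | (fun x => dft H (fun y => F (x, y)) ψ) ≠ 0}
  refine ⟨T.card, (support fun y => F (x₀, y)).ncard, hTne.card_pos, T.card_le_univ, ?_, ?_, ?_, ?_⟩
  · rw [Nat.one_le_iff_ne_zero, Ne, Set.ncard_eq_zero, support_eq_empty_iff]
    exact hx₀F
  · rw [← Nat.card_eq_fintype_card]
    exact Set.ncard_le_card _
  · rw [Set.ncard_eq_toFinset_card' (support F),
      Finset.card_eq_sum_card_fiberwise (f := Prod.fst) (t := T), ← smul_eq_mul]
    · refine Finset.card_nsmul_le_sum _ _ _ fun x hx => (hmin x hx).trans ?_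
      rw [Set.ncard_eq_toFinset_card']
      refine Finset.card_le_card_of_injOn (fun y => (x, y)) (fun y hy => ?_) ?_
      · simpa using hy
      · intro y _ z _ h
        exact (Prod.mk.inj h).2
    · rintro ⟨x, y⟩ hz
      refine Finset.mem_filter.2 ⟨Finset.mem_univ _, fun h => ?_⟩
      exact (by simpa using hz : F (x, y) ≠ 0) (congrFun h y)
  · have hW : b (support fun y => F (x₀, y)).ncard ≤ W.card := by
      refine (hbH _ hx₀F).trans ?_
      rw [← Set.ncard_coe_finset]
      refine Set.ncard_le_ncard (fun ψ hψ => ?_) (Finset.finite_toSet _)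
      exact Finset.mem_filter.2 ⟨Finset.mem_univ _, fun h => hψ (congrFun h x₀)⟩
    have himg : (support (dft (G × H) F)).ncard =
        ({z | dft (G × H) F (z.1.prodMk z.2) ≠ 0} : Finset (AddChar G ℂ × AddChar H ℂ)).card := by
      rw [← Set.ncard_coe_finset,
        ← Set.ncard_image_of_injective _ (AddChar.prodEquiv (G := G) (H := H)).injective]
      congr 1
      ext χ
      obtain ⟨z, rfl⟩ := AddChar.prodEquiv.surjective χ
      rw [AddChar.prodEquiv.injective.mem_set_image]
      simp [AddChar.prodEquiv]
    refine (Nat.mul_le_mul_left _ hW).trans ?_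
    rw [himg, mul_comm, ← smul_eq_mul]
    refine le_trans ?_ (Finset.card_le_card (Finset.filter_subset (fun z => z.2 ∈ W) _))
    rw [Finset.card_eq_sum_card_fiberwise (f := Prod.snd) (t := W)]
    · refine Finset.card_nsmul_le_sum _ _ _ fun ψ hψ => ?_
      refine (ha ?_).trans ((haG _ (Finset.mem_filter.1 hψ).2).trans ?_)
      · rw [← Set.ncard_coe_finset T]
        refine Set.ncard_le_ncard (fun x hx => ?_) (Finset.finite_toSet _)
        refine Finset.mem_filter.2 ⟨Finset.mem_univ _, fun h => hx ?_⟩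
        have h' (y : H) : F (x, y) = 0 := congrFun h y
        simp [dft, h']
      · rw [Set.ncard_eq_toFinset_card']
        refine Finset.card_le_card_of_injOn (fun χ => (χ, ψ)) (fun χ hχ => ?_) ?_
        · have hχ' : dft G (fun x => dft H (fun y => F (x, y)) ψ) χ ≠ 0 := by simpa using hχ
          rw [← dft_prodMk] at hχ'
          simp [hψ, hχ']
        · intro y _ z _ h
          exact (Prod.mk.inj h).1
    · intro z hz
      exact (Finset.mem_filter.1 hz).2

end Product

lemma theta_le {p q k s t : ℕ} [Fact p.Prime] [Fact q.Prime] (hs : 1 ≤ s) (hsq : s ≤ q)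
    (ht : 1 ≤ t) (htp : t ≤ p) (hst : s * t ≤ k) :
    theta (ZMod q × ZMod p) k ≤ (q - s + 1) * (p - t + 1) := by
  obtain ⟨f, hf0, hf, hf'⟩ := exists_card_support_le_card_support_dft_le (G := ZMod q) hs
    (by rwa [ZMod.card])
  obtain ⟨g, hg0, hg, hg'⟩ := exists_card_support_le_card_support_dft_le (G := ZMod p) ht
    (by rwa [ZMod.card])
  rw [ZMod.card] at hf' hg'
  refine le_trans ?_ ((ncard_support_dft_mul f g).trans_le (Nat.mul_le_mul hf' hg'))
  refine Nat.sInf_le ⟨fun z => f z.1 * g z.2, ?_, ?_, rfl⟩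
  · obtain ⟨x, hx⟩ := ne_iff.1 hf0
    obtain ⟨y, hy⟩ := ne_iff.1 hg0
    exact ne_iff.2 ⟨(x, y), mul_ne_zero hx hy⟩
  · refine le_trans (le_of_eq ?_) ((Nat.mul_le_mul hf hg).trans hst)
    rw [← Set.ncard_prod]
    congr 1
    ext z
    simp

/-- Meshulam's lower bound for `θ` on `ℤ/qℤ × ℤ/pℤ` in terms of the factors. -/
lemma exists_mul_le_theta {p q k : ℕ} [Fact p.Prime] [Fact q.Prime] (hk : 1 ≤ k) :
    ∃ s t : ℕ, 1 ≤ s ∧ s ≤ q ∧ 1 ≤ t ∧ t ≤ p ∧ s * t ≤ k ∧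
      ((q : ℤ) - s + 1) * ((p : ℤ) - t + 1) ≤ theta (ZMod q × ZMod p) k := by
  have hne : {l | ∃ f : ZMod q × ZMod p → ℂ, f ≠ 0 ∧ (support f).ncard ≤ k ∧
      (support (dft _ f)).ncard = l}.Nonempty := by
    refine ⟨_, Pi.single 0 1, by simp, ?_, rfl⟩
    refine le_trans ?_ hk
    rw [Set.ncard_le_one]
    intro a ha b hb
    have h (c : ZMod q × ZMod p) (hc : c ∈ support (Pi.single (0 : ZMod q × ZMod p) (1 : ℂ))) :
        c = 0 := by
      by_contra h
      exact hc (Pi.single_eq_of_ne h _)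
    rw [h a ha, h b hb]
  obtain ⟨F, hF0, hFk, hF⟩ := Nat.sInf_mem hne
  have hcard {n : ℕ} [Fact n.Prime] (f : ZMod n → ℂ) (hf : f ≠ 0) :
      n - (support f).ncard + 1 ≤ (support (dft _ f)).ncard := by
    have h1 := card_support_add_card_support_dft_ge hf
    have h2 : (support f).ncard ≤ n := by
      simpa using Set.ncard_le_card (support f)
    omega
  obtain ⟨s, t, hs, hsq, ht, htp, hst, hle⟩ := exists_mul_le_ncard_support_dft hF0
    (a := fun s => q - s + 1) (b := fun t => p - t + 1)
    (fun x y hxy => by dsimp only; omega) hcard hcard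
  rw [ZMod.card] at hsq htp
  refine ⟨s, t, hs, hsq, ht, htp, hst.trans hFk, ?_⟩
  rw [theta, ← hF]
  zify at hle
  rwa [Nat.cast_sub hsq, Nat.cast_sub htp] at hle

section Arithmetic

/-! Lower bounds for `(q - s + 1) * (p - t + 1)` on the region `s * t ≤ k`: by concavity in `s`
the minimum is attained at an endpoint. -/

variable {p q k s t : ℤ}

lemma right_mul_sub_add_one_le (hqp : q < p) (hs : 1 ≤ s) (hsq : s ≤ q) (ht : 1 ≤ t)
    (hst : s * t ≤ k) : p * (q - k + 1) ≤ (q - s + 1) * (p - t + 1) := by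
  have hsk : s ≤ k := by nlinarith
  have h1 : 0 ≤ s * (p + 1) - (q + 1) := by nlinarith
  refine le_of_mul_le_mul_left ?_ (by omega : 0 < s)
  linear_combination mul_nonneg (sub_nonneg.2 hsk) h1 +
    mul_le_mul_of_nonneg_left hst (by omega : 0 ≤ q - s + 1)

lemma mul_add_one_sub_le_of_le (hp : 0 ≤ p) (hs : 1 ≤ s) (hsq : s ≤ q) (hst : s * t ≤ k)
    (hk : k * (q + 1) ≤ q * (p + 1)) : q * (p + 1) - k ≤ q * ((q - s + 1) * (p - t + 1)) := by
  have h1 : 0 ≤ q * s * (p + 1) - k * (q + 1) := by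
    have : 0 ≤ (s - 1) * (q * (p + 1)) :=
      mul_nonneg (by omega) (mul_nonneg (by omega) (by omega))
    linarith
  refine le_of_mul_le_mul_left ?_ (by omega : 0 < s)
  linear_combination mul_nonneg (sub_nonneg.2 hsq) h1 +
    mul_le_mul_of_nonneg_left hst (mul_nonneg (by omega : 0 ≤ q) (by omega : 0 ≤ q - s + 1))

lemma left_mul_sub_add_one_le (hp : 0 ≤ p) (hs : 1 ≤ s) (hsq : s ≤ q) (hst : s * t ≤ k)
    (hk : q * (p + 1) ≤ k * (q + 1)) : q * (p - k + 1) ≤ (q - s + 1) * (p - t + 1) := by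
  have h1 : 0 ≤ k * (q + 1) - s * (p + 1) := by
    have : 0 ≤ (q - s) * (p + 1) := mul_nonneg (by omega) (by omega)
    linarith
  refine le_of_mul_le_mul_left ?_ (by omega : 0 < s)
  linear_combination mul_nonneg (sub_nonneg.2 hs) h1 +
    mul_le_mul_of_nonneg_left hst (by omega : 0 ≤ q - s + 1)

lemma mul_add_one_sub_le_of_lt (hp : 0 ≤ p) (hqp : q < p) (hsq : s ≤ q) (htp : t ≤ p)
    (hst : s * t ≤ k) : p * (q + 1) - k ≤ p * ((q - s + 1) * (p - t + 1)) := by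
  have h1 : 0 ≤ (q - s) * (p - t) := mul_nonneg (by omega) (by omega)
  linear_combination hst + (p + 1) * h1 +
    mul_nonneg (sub_nonneg.2 hqp.le) (sub_nonneg.2 htp)

end Arithmetic

/-- If `θ` is an integer with `m * θ ≥ m * (n + 1) - k`, then `θ ≥ n - ⌊k/m⌋ + 1`. -/
lemma sub_div_add_one_le {m n k l : ℕ} (hm : 0 < m) (hd : k / m ≤ n)
    (h : (m : ℤ) * (n + 1) - k ≤ m * l) : n - k / m + 1 ≤ l := by
  suffices n + 1 - l ≤ k / m by omega
  rw [Nat.le_div_iff_mul_le hm]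
  obtain hl | hl := le_total (n + 1) l
  · simp [Nat.sub_eq_zero_of_le hl]
  · zify [hl]
    linarith

/-- Meshulam's function for `G = ℤ/qℤ × ℤ/pℤ`, `q < p` primes. The conditions
`k ≤ q(p+1)/(q+1)` and `q(p+1)/(q+1) ≤ k` are written as `k(q+1) ≤ q(p+1)` and
`q(p+1) ≤ k(q+1)`; `⌊k/q⌋` is natural division `k / q`. -/
theorem theta_two_primes (p q : ℕ) [Fact p.Prime] [Fact q.Prime] (hqp : q < p) :
    (∀ k : ℕ, 1 ≤ k → k ≤ q →
      theta (ZMod q × ZMod p) k = p * (q - k + 1)) ∧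
    (∀ k : ℕ, q ≤ k → k * (q + 1) ≤ q * (p + 1) →
      theta (ZMod q × ZMod p) k = p - k / q + 1) ∧
    (∀ k : ℕ, q * (p + 1) ≤ k * (q + 1) → k ≤ p →
      theta (ZMod q × ZMod p) k = q * (p - k + 1)) ∧
    (∀ k : ℕ, p ≤ k → k ≤ p * q →
      theta (ZMod q × ZMod p) k = q - k / p + 1) := by
  have hq : 1 < q := (Fact.out : q.Prime).one_lt
  have hqp' : (q : ℤ) < p := by exact_mod_cast hqp
  refine ⟨fun k hk hkq => le_antisymm ?_ ?_, fun k hqk hk => ?_, fun k hk hkp => le_antisymm ?_ ?_,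
    fun k hpk hk => ?_⟩
  · refine (theta_le (s := k) (t := 1) hk hkq le_rfl (by omega) (by omega)).trans (le_of_eq ?_)
    rw [Nat.sub_add_cancel (by omega), mul_comm]
  · obtain ⟨s, t, hs, hsq, ht, htp, hst, hle⟩ := exists_mul_le_theta (p := p) (q := q) hk
    zify [hkq] at *
    exact (right_mul_sub_add_one_le hqp' hs hsq ht hst).trans hle
  · have hkp : k ≤ q * p := by nlinarith
    have hd : k / q ≤ p := Nat.div_le_of_le_mul hkp
    refine le_antisymm ?_ ?_
    · refine (theta_le (s := q) (t := k / q) (by omega) le_rfl (Nat.div_pos hqk (by omega)) hd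
        (Nat.mul_div_le _ _)).trans (le_of_eq ?_)
      simp
    · obtain ⟨s, t, hs, hsq, ht, htp, hst, hle⟩ :=
        exists_mul_le_theta (p := p) (q := q) (k := k) (by omega)
      refine sub_div_add_one_le (by omega) hd
        (le_trans ?_ (mul_le_mul_of_nonneg_left hle (by omega)))
      zify at *
      exact mul_add_one_sub_le_of_le (by omega) hs hsq hst hk
  · have hk1 : 1 ≤ k := by
      by_contra h
      obtain rfl : k = 0 := by omega
      nlinarith
    refine (theta_le (s := 1) (t := k) le_rfl hq.le hk1 hkp (by omega)).trans (le_of_eq ?_)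
    rw [Nat.sub_add_cancel (by omega)]
  · have hk1 : 1 ≤ k := by
      by_contra h
      obtain rfl : k = 0 := by omega
      nlinarith
    obtain ⟨s, t, hs, hsq, ht, htp, hst, hle⟩ := exists_mul_le_theta (p := p) (q := q) hk1
    zify [hkp] at *
    exact (left_mul_sub_add_one_le (by omega) hs hsq hst hk).trans hle
  · have hd : k / p ≤ q := Nat.div_le_of_le_mul hk
    refine le_antisymm ?_ ?_
    · refine (theta_le (s := k / p) (t := p) (Nat.div_pos hpk (by omega)) hd (by omega) le_rfl
        (Nat.div_mul_le_self _ _)).trans (le_of_eq ?_)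
      simp
    · obtain ⟨s, t, hs, hsq, ht, htp, hst, hle⟩ :=
        exists_mul_le_theta (p := p) (q := q) (k := k) (by omega)
      refine sub_div_add_one_le (by omega) hd
        (le_trans ?_ (mul_le_mul_of_nonneg_left hle (by omega)))
      zify at *
      exact mul_add_one_sub_le_of_lt (by omega) hqp' hsq htp hst
end

section
/- Let p and q be prime numbers with 1 < q < p, G = ℤ/qℤ × ℤ/pℤ, and 1 ≤ k ≤ q. Then every equality case for (k, G) is of the form (x, y) ↦ f(x) δ_a(y), where a ∈ ℤ/pℤ, δ_a is the indicator function of {a}, and f : ℤ/qℤ → ℂ satisfies |supp(f)| = k and |supp(f̂)| = q - k + 1. -/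
open Function

/-- An equality case for `(k, G)`: a nonzero function with support of size exactly `k`
and spectrum of minimal size `θ(k, G)`. -/
def IsEqualityCase (G : Type*) [AddCommGroup G] [Fintype G] (k : ℕ) (f : G → ℂ) : Prop :=
  f ≠ 0 ∧ (support f).ncard = k ∧ (support (dft G f)).ncard = theta G k

open Polynomial in
/-- If the reductions `a j` are distinct and `∑ j, c j * X ^ a j` has a zero of order at least
the number of its terms at `1`, then it is zero. -/
theorem sparse_eq_zero_of_X_sub_one_pow_dvd {F : Type*} [CommRing F] [IsDomain F] {m : ℕ}
    (a : Fin m → ℕ) (ha : Injective fun j => (a j : F)) (c : Fin m → F)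
    (h : (X - C 1) ^ m ∣ ∑ j, C (c j) * X ^ a j) : c = 0 := by
  have key : ∀ i : ℕ, i ≤ m →
      (X - C (1 : F)) ^ (m - i) ∣ ∑ j, C (c j * (a j : F) ^ i) * X ^ a j := by
    intro i
    induction i with
    | zero => intro _; simpa using h
    | succ i ih =>
      intro hi
      obtain ⟨Q, hQ⟩ := ih (by omega)
      have hd := congrArg (fun P => X * derivative P) hQ
      have e : m - i = (m - (i + 1)) + 1 := by omega
      have hl : X * derivative (∑ j, C (c j * (a j : F) ^ i) * X ^ a j) =
          ∑ j, C (c j * (a j : F) ^ (i + 1)) * X ^ a j := by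
        rw [derivative_sum, Finset.mul_sum]
        refine Finset.sum_congr rfl fun j _ => ?_
        rw [derivative_C_mul_X_pow]
        rcases Nat.eq_zero_or_pos (a j) with h0 | h0
        · simp [h0]
        · obtain ⟨t, ht⟩ := Nat.exists_eq_add_of_lt h0
          simp only [ht, map_mul, map_pow, pow_succ]
          simp
          ring
      rw [← hl]
      simp only [hQ, derivative_mul, e, derivative_X_sub_C_pow]
      refine Dvd.dvd.mul_left (dvd_add ?_ ?_) _
      · rw [Nat.add_sub_cancel]
        exact ((dvd_refl _).mul_left _).mul_right _
      · exact (pow_dvd_pow _ (Nat.le_succ _)).mul_right _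
  refine Matrix.eq_zero_of_forall_pow_sum_mul_pow_eq_zero ha fun i => ?_
  obtain ⟨Q, hQ⟩ := key i i.2.le
  have hi : m - (i : ℕ) ≠ 0 := by omega
  simpa [eval_finsetSum, hi] using congrArg (Polynomial.eval 1) hQ

open Polynomial in
theorem dvd_of_forall_sum_mul_pow_eq_zero {R : Type*} [CommRing R] [IsDomain R] {p m : ℕ}
    {ζ : R} (hζ : IsPrimitiveRoot ζ p) (hprime : Prime (ζ - 1))
    (hdvd : ∀ n : ℤ, ζ - 1 ∣ (n : R) → (p : ℤ) ∣ n)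
    {a b : Fin m → ℕ} (ha : Injective a) (hap : ∀ j, a j < p) (hb : Injective b)
    (hbp : ∀ i, b i < p) {c : Fin m → R}
    (h : ∀ i, ∑ j, c j * ζ ^ (a j * b i) = 0) (j : Fin m) : ζ - 1 ∣ c j := by
  classical
  set P : R[X] := ∑ j, C (c j) * X ^ a j with hP
  let I : Ideal R := Ideal.span {ζ - 1}
  have : I.IsPrime := (Ideal.span_singleton_prime hprime.ne_zero).2 hprime
  have hmk : ∀ x, Ideal.Quotient.mk I x = 0 ↔ ζ - 1 ∣ x := fun x => by
    rw [Ideal.Quotient.eq_zero_iff_mem, Ideal.mem_span_singleton]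
  have hzb : Injective fun i => ζ ^ b i := fun i i' hii =>
    hb (hζ.pow_inj (hbp i) (hbp i') hii)
  have hdiv : ∏ i, (X - C (ζ ^ b i)) ∣ P := by
    by_cases hP0 : P = 0
    · rw [hP0]; exact dvd_zero _
    have hs : (Finset.univ.image fun i => ζ ^ b i).val ≤ P.roots := by
      rw [Finset.val_le_iff_val_subset]
      intro x hx
      obtain ⟨i, -, rfl⟩ := Finset.mem_image.1 (show x ∈ Finset.univ.image fun i => ζ ^ b i from hx)
      rw [mem_roots hP0, IsRoot, hP, eval_finsetSum, ← h i]
      refine Finset.sum_congr rfl fun j _ => ?_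
      rw [eval_mul, eval_C, eval_pow, eval_X, ← pow_mul, mul_comm (b i)]
    have := (Multiset.prod_X_sub_C_dvd_iff_le_roots hP0 _).2 hs
    rwa [← Finset.prod_eq_multiset_prod, Finset.prod_image fun _ _ _ _ e => hzb e] at this
  have hζ1 : Ideal.Quotient.mk I ζ = 1 := by
    rw [← sub_eq_zero, ← map_one (Ideal.Quotient.mk I), ← map_sub, hmk]
  have hdiv' := Polynomial.map_dvd (Ideal.Quotient.mk I) hdiv
  have hainj : Injective fun j => (a j : R ⧸ I) := by
    intro j j' hjj
    have h1 : ζ - 1 ∣ (((a j : ℤ) - a j' : ℤ) : R) := by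
      rw [← hmk]; simpa [sub_eq_zero] using hjj
    have h2 := hdvd _ h1
    have := hap j; have := hap j'
    refine ha (Nat.ModEq.eq_of_lt_of_lt (m := p) ?_ (hap j) (hap j'))
    exact ((Nat.modEq_iff_dvd).2 h2).symm
  have := sparse_eq_zero_of_X_sub_one_pow_dvd a hainj
    (fun j => Ideal.Quotient.mk I (c j)) (by
      simpa [hP, Polynomial.map_sum, Polynomial.map_prod, hζ1] using hdiv')
  exact (hmk _).1 (congrFun this j)

theorem eq_zero_of_forall_sum_mul_pow_eq_zero {R : Type*} [CommRing R] [IsDomain R]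
    [IsNoetherianRing R] {p m : ℕ}
    {ζ : R} (hζ : IsPrimitiveRoot ζ p) (hprime : Prime (ζ - 1))
    (hdvd : ∀ n : ℤ, ζ - 1 ∣ (n : R) → (p : ℤ) ∣ n)
    {a b : Fin m → ℕ} (ha : Injective a) (hap : ∀ j, a j < p) (hb : Injective b)
    (hbp : ∀ i, b i < p) {c : Fin m → R}
    (h : ∀ i, ∑ j, c j * ζ ^ (a j * b i) = 0) : c = 0 := by
  have key : ∀ n : ℕ, ∀ c : Fin m → R, (∀ i, ∑ j, c j * ζ ^ (a j * b i) = 0) →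
      ∀ j, (ζ - 1) ^ n ∣ c j := by
    intro n
    induction n with
    | zero => intro c _ j; simp
    | succ n ih =>
      intro c hc
      choose d hd using dvd_of_forall_sum_mul_pow_eq_zero hζ hprime hdvd ha hap hb hbp hc
      have hd0 : ∀ i, ∑ j, d j * ζ ^ (a j * b i) = 0 := fun i => by
        refine (mul_eq_zero.1 ?_).resolve_left hprime.ne_zero
        rw [Finset.mul_sum, ← hc i]
        exact Finset.sum_congr rfl fun j _ => by rw [hd j, mul_assoc]
      intro j
      rw [hd j, pow_succ']
      exact mul_dvd_mul_left _ (ih d hd0 j)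
  funext j
  by_contra hj
  obtain ⟨n, hn⟩ := FiniteMultiplicity.of_prime_left hprime hj
  exact hn (key _ c h j)

open NumberField in
theorem det_pow_mul_ne_zero_of_ringHom {p m : ℕ} [hp : Fact p.Prime] {K : Type*} [Field K]
    [CharZero K] [IsCyclotomicExtension {p} ℚ K] (φ : K →+* ℂ) {ω : ℂ} (hω : IsPrimitiveRoot ω p)
    {a b : Fin m → ℕ} (ha : Injective a) (hap : ∀ j, a j < p) (hb : Injective b)
    (hbp : ∀ i, b i < p) : (Matrix.of fun i j => ω ^ (a j * b i)).det ≠ 0 := by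
  have : NeZero p := ⟨hp.out.ne_zero⟩
  have : NumberField K := IsCyclotomicExtension.numberField {p} ℚ K
  have hζ₀ := IsCyclotomicExtension.zeta_spec p ℚ K
  obtain ⟨k, -, hk, hkω⟩ := ((hζ₀.map_of_injective φ.injective).isPrimitiveRoot_iff).1 hω
  have hζ : IsPrimitiveRoot (IsCyclotomicExtension.zeta p ℚ K ^ k) p :=
    hζ₀.pow_of_coprime k hk
  let ψ : 𝓞 K →+* ℂ := φ.comp (algebraMap (𝓞 K) K)
  have hψ : Injective ψ := φ.injective.comp RingOfIntegers.coe_injective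
  have hψω : ψ hζ.toInteger = ω := by
    rw [← hkω, ← map_pow]; rfl
  have hdet : (Matrix.of fun i j => hζ.toInteger ^ (a j * b i)).det ≠ 0 := by
    intro h0
    obtain ⟨c, hc, h⟩ := Matrix.exists_mulVec_eq_zero_iff.2 h0
    refine hc (eq_zero_of_forall_sum_mul_pow_eq_zero hζ.toInteger_isPrimitiveRoot
      hζ.zeta_sub_one_prime' (fun n hn => ?_) ha hap hb hbp (c := c) fun i => ?_)
    · exact (IsCyclotomicExtension.Rat.zeta_sub_one_dvd_intCast_iff' p hζ).1 hn
    · simpa [Matrix.mulVec, dotProduct, mul_comm] using congrFun h i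
  intro h
  apply hdet
  apply hψ
  rw [map_zero, RingHom.map_det, ← h]
  congr 1
  ext i j
  simp [hψω]

/-- Chebotarev's theorem: every minor of the Fourier matrix of prime order is nonzero. -/
theorem det_pow_mul_ne_zero {p m : ℕ} [hp : Fact p.Prime] {ω : ℂ} (hω : IsPrimitiveRoot ω p)
    {a b : Fin m → ℕ} (ha : Injective a) (hap : ∀ j, a j < p) (hb : Injective b)
    (hbp : ∀ i, b i < p) : (Matrix.of fun i j => ω ^ (a j * b i)).det ≠ 0 := by
  have : NeZero p := ⟨hp.out.ne_zero⟩
  have : IsCyclotomicExtension {p} ℚ (CyclotomicField p ℚ) := by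
    convert! CyclotomicField.isCyclotomicExtension p ℚ
  have : NumberField (CyclotomicField p ℚ) := IsCyclotomicExtension.numberField {p} ℚ _
  obtain ⟨φ⟩ : Nonempty (CyclotomicField p ℚ →+* ℂ) := inferInstance
  exact det_pow_mul_ne_zero_of_ringHom φ hω ha hap hb hbp

theorem stdAddChar_neg_mul {p : ℕ} [NeZero p] (x y : ZMod p) :
    ZMod.stdAddChar (-(x * y)) = (ZMod.stdAddChar (-1 : ZMod p)) ^ (x.val * y.val) := by
  rw [← AddChar.map_nsmul_eq_pow]
  simp

theorem isPrimitiveRoot_stdAddChar_neg_one (p : ℕ) [NeZero p] :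
    IsPrimitiveRoot (ZMod.stdAddChar (-1 : ZMod p)) p := by
  refine ⟨?_, fun l hl => ?_⟩
  · rw [← AddChar.map_nsmul_eq_pow]
    simp
  · rw [← AddChar.map_nsmul_eq_pow, ← (ZMod.stdAddChar (N := p)).map_zero_eq_one] at hl
    have := ZMod.injective_stdAddChar hl
    rw [← ZMod.natCast_eq_zero_iff]
    simpa using this

theorem zdft_eq_dft (n : ℕ) [NeZero n] (f : ZMod n → ℂ) : zdft n f = ZMod.dft f := by
  funext y
  rw [zdft, ZMod.dft_apply]
  refine Finset.sum_congr rfl fun x _ => ?_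
  have h : -(x * y) = ((-(x.val * y.val : ℕ) : ℤ) : ZMod n) := by simp
  rw [h, ZMod.stdAddChar_coe, smul_eq_mul, mul_comm]
  congr 2
  push_cast
  ring

/-- The uncertainty principle on a cyclic group of prime order. -/
theorem succ_le_ncard_support_add_ncard_support_dft {p : ℕ} [hp : Fact p.Prime]
    {f : ZMod p → ℂ} (hf : f ≠ 0) :
    p + 1 ≤ (support f).ncard + (support (ZMod.dft f)).ncard := by
  classical
  by_contra! hlt
  have hcompl := Set.ncard_add_ncard_compl (support (ZMod.dft f))
  rw [Nat.card_zmod] at hcompl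
  obtain ⟨B, hB, hBcard⟩ := Set.exists_subset_card_eq
    (show (support f).ncard ≤ (support (ZMod.dft f))ᶜ.ncard by omega)
  let eA : Fin (support f).ncard ≃ support f := (Finite.equivFinOfCardEq rfl).symm
  let eB : Fin (support f).ncard ≃ B := (Finite.equivFinOfCardEq hBcard).symm
  have hdet := det_pow_mul_ne_zero (isPrimitiveRoot_stdAddChar_neg_one p)
    (a := fun j => (eA j : ZMod p).val) (b := fun i => (eB i : ZMod p).val)
    ((ZMod.val_injective p).comp (Subtype.val_injective.comp eA.injective))
    (fun _ => ZMod.val_lt _)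
    ((ZMod.val_injective p).comp (Subtype.val_injective.comp eB.injective))
    (fun _ => ZMod.val_lt _)
  have hv := Matrix.eq_zero_of_mulVec_eq_zero hdet (v := fun j => f (eA j)) (by
    funext i
    have hi : ZMod.dft f (eB i) = 0 := by simpa using hB (eB i).2
    rw [Pi.zero_apply, ← hi, ZMod.dft_apply]
    simp only [Matrix.mulVec, dotProduct, Matrix.of_apply, ← stdAddChar_neg_mul, smul_eq_mul]
    rw [eA.sum_comp (fun x => ZMod.stdAddChar (-((x : ZMod p) * (eB i : ZMod p))) * f x),
      ← Finset.sum_subtype (Finset.univ.filter (· ∈ support f)) (by simp)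
        (fun x => ZMod.stdAddChar (-(x * (eB i : ZMod p))) * f x)]
    refine Finset.sum_subset (Finset.subset_univ _) fun x _ hx => ?_
    have hx0 : f x = 0 := by simpa using hx
    rw [hx0, mul_zero])
  obtain ⟨x, hx⟩ := Function.ne_iff.1 hf
  have := congrFun hv (eA.symm ⟨x, hx⟩)
  simp at this
  exact hx this

theorem exists_ne_zero_support_subset_dft_eq_zero {n : ℕ} [NeZero n] {A B : Finset (ZMod n)}
    (h : B.card < A.card) : ∃ f : ZMod n → ℂ, f ≠ 0 ∧ support f ⊆ A ∧
      support (ZMod.dft f) ⊆ (↑B)ᶜ := by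
  classical
  let E : (A → ℂ) →ₗ[ℂ] (ZMod n → ℂ) := Function.ExtendByZero.linearMap ℂ Subtype.val
  let R : (ZMod n → ℂ) →ₗ[ℂ] (B → ℂ) := LinearMap.funLeft ℂ ℂ Subtype.val
  have hk := LinearMap.ker_ne_bot_of_finrank_lt
    (f := R ∘ₗ (ZMod.dft : (ZMod n → ℂ) ≃ₗ[ℂ] _).toLinearMap ∘ₗ E) (by simpa using h)
  obtain ⟨v, hv, hv0⟩ := (Submodule.ne_bot_iff _).1 hk
  refine ⟨E v, fun h0 => hv0 ?_, fun x hx => ?_, fun y hy hyB => hy ?_⟩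
  · funext a
    simpa [E, Subtype.val_injective.extend_apply] using congrFun h0 a
  · by_contra hxA
    refine hx (Function.extend_apply' _ _ _ ?_)
    rintro ⟨a, rfl⟩
    exact hxA a.2
  · exact congrFun (LinearMap.mem_ker.1 hv) ⟨y, hyB⟩

/-- The character of `ℤ/qℤ × ℤ/pℤ` with frequency `(s, t)`. -/
noncomputable def prodAddChar (q p : ℕ) [NeZero q] [NeZero p] (st : ZMod q × ZMod p) :
    AddChar (ZMod q × ZMod p) ℂ :=
  ((ZMod.stdAddChar.mulShift st.1).compAddMonoidHom (AddMonoidHom.fst _ _)) *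
    ((ZMod.stdAddChar.mulShift st.2).compAddMonoidHom (AddMonoidHom.snd _ _))

theorem prodAddChar_apply {q p : ℕ} [NeZero q] [NeZero p] (st x : ZMod q × ZMod p) :
    prodAddChar q p st x = ZMod.stdAddChar (st.1 * x.1) * ZMod.stdAddChar (st.2 * x.2) := rfl

theorem prodAddChar_bijective (q p : ℕ) [NeZero q] [NeZero p] :
    Bijective (prodAddChar q p) := by
  classical
  rw [Fintype.bijective_iff_injective_and_card, AddChar.card_eq]
  refine ⟨fun st st' h => Prod.ext ?_ ?_, rfl⟩
  · simpa [prodAddChar_apply, ZMod.injective_stdAddChar.eq_iff] using DFunLike.congr_fun h (1, 0)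
  · simpa [prodAddChar_apply, ZMod.injective_stdAddChar.eq_iff] using DFunLike.congr_fun h (0, 1)

theorem dft_prodAddChar {q p : ℕ} [NeZero q] [NeZero p] (F : ZMod q × ZMod p → ℂ)
    (st : ZMod q × ZMod p) : dft (ZMod q × ZMod p) F (prodAddChar q p st) =
      ZMod.dft (fun y => ZMod.dft (fun x => F (x, y)) st.1) st.2 := by
  simp only [dft, ZMod.dft_apply, prodAddChar_apply, smul_eq_mul, Finset.mul_sum]
  rw [Fintype.sum_prod_type_right]
  refine Finset.sum_congr rfl fun y _ => Finset.sum_congr rfl fun x _ => ?_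
  simp only [Prod.fst_neg, Prod.snd_neg, mul_neg]
  rw [mul_comm st.1, mul_comm st.2]
  ring

theorem ncard_support_dft_prod {q p : ℕ} [NeZero q] [NeZero p] (F : ZMod q × ZMod p → ℂ) :
    (support (dft (ZMod q × ZMod p) F)).ncard = (support fun st : ZMod q × ZMod p =>
      ZMod.dft (fun y => ZMod.dft (fun x => F (x, y)) st.1) st.2).ncard := by
  rw [← Set.ncard_preimage_of_injective_subset_range (prodAddChar_bijective q p).1
    (by simp [(prodAddChar_bijective q p).2.range_eq])]
  congr 1
  ext st
  simp [dft_prodAddChar]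

theorem ncard_support_dft_mul_indicator {q p : ℕ} [NeZero q] [NeZero p] (g : ZMod q → ℂ)
    (a : ZMod p) : (support (dft (ZMod q × ZMod p)
      fun x => g x.1 * (if x.2 = a then 1 else 0))).ncard =
        (support (ZMod.dft g)).ncard * p := by
  rw [ncard_support_dft_prod]
  have : (support fun st : ZMod q × ZMod p => ZMod.dft (fun y =>
      ZMod.dft (fun x => g x * (if y = a then (1 : ℂ) else 0)) st.1) st.2) =
        support (ZMod.dft g) ×ˢ Set.univ := by
    ext st
    have h : ZMod.dft (fun y => ZMod.dft (fun x => g x * (if y = a then (1 : ℂ) else 0)) st.1) st.2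
        = ZMod.stdAddChar (-(a * st.2)) * ZMod.dft g st.1 := by
      rw [ZMod.dft_apply, Finset.sum_eq_single a]
      · simp
      · intro y _ hy
        simp [hy, ZMod.dft_apply]
      · simp
    rw [mem_support, h]
    have hne := ((ZMod.stdAddChar (N := p)).val_isUnit (-(a * st.2))).ne_zero
    simp [hne]
  rw [this, Set.ncard_prod, Set.ncard_univ, Nat.card_zmod]

theorem ncard_support_mul_indicator {α β : Type*} [DecidableEq β] (g : α → ℂ) (a : β) :
    (support fun x : α × β => g x.1 * (if x.2 = a then 1 else 0)).ncard =
      (support g).ncard := by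
  have : (support fun x : α × β => g x.1 * (if x.2 = a then 1 else 0)) =
      support g ×ˢ {a} := by
    ext; simp [and_comm]
  rw [this, Set.ncard_prod, Set.ncard_singleton, mul_one]

theorem theta_zmod_prod_le {q p k : ℕ} [NeZero q] [NeZero p] (hk1 : 1 ≤ k) (hk2 : k ≤ q) :
    theta (ZMod q × ZMod p) k ≤ (q - k + 1) * p := by
  obtain ⟨A, -, hA⟩ := Finset.exists_subset_card_eq
    (show k ≤ (Finset.univ : Finset (ZMod q)).card by simpa [ZMod.card])
  obtain ⟨B, -, hB⟩ := Finset.exists_subset_card_eq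
    (show k - 1 ≤ (Finset.univ : Finset (ZMod q)).card by simp [ZMod.card]; omega)
  obtain ⟨g, hg0, hgA, hgB⟩ := exists_ne_zero_support_subset_dft_eq_zero
    (show B.card < A.card by omega)
  let F : ZMod q × ZMod p → ℂ := fun x => g x.1 * (if x.2 = 0 then 1 else 0)
  refine (Nat.sInf_le ⟨F, ?_, ?_, rfl⟩ : theta (ZMod q × ZMod p) k ≤
    (support (dft (ZMod q × ZMod p) F)).ncard).trans ?_
  rotate_left 2
  · rw [ncard_support_dft_mul_indicator]
    refine Nat.mul_le_mul_right _ ((Set.ncard_le_ncard hgB).trans ?_)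
    have := Set.ncard_add_ncard_compl (B : Set (ZMod q))
    rw [Set.ncard_coe_finset, Nat.card_zmod] at this
    omega
  · obtain ⟨x, hx⟩ := Function.ne_iff.1 hg0
    exact Function.ne_iff.2 ⟨(x, 0), by simpa [F] using hx⟩
  · rw [ncard_support_mul_indicator]
    exact (Set.ncard_le_ncard hgA).trans (by simp [hA])

theorem mul_le_ncard_support_dft_prod {q p : ℕ} [NeZero q] [Fact p.Prime]
    (F : ZMod q × ZMod p → ℂ) (y : ZMod p) :
    (support (ZMod.dft fun x => F (x, y))).ncard *
      (p + 1 - {y | (fun x => F (x, y)) ≠ 0}.ncard) ≤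
        (support (dft (ZMod q × ZMod p) F)).ncard := by
  classical
  rw [ncard_support_dft_prod]
  set H : ZMod q → ZMod p → ℂ := fun s y => ZMod.dft (fun x => F (x, y)) s with hH
  let S : Finset (ZMod q) := (support fun s => H s y).toFinset
  let U : Finset (ZMod q × ZMod p) := Finset.univ.filter fun st =>
    st.1 ∈ S ∧ ZMod.dft (H st.1) st.2 ≠ 0
  have hU : (U : Set (ZMod q × ZMod p)) ⊆ support fun st => ZMod.dft (H st.1) st.2 := by
    intro st hst
    exact (Finset.mem_filter.1 hst).2.2
  have hle := Finset.mul_card_image_le_card_of_maps_to (f := Prod.fst) (s := U) (t := S)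
    (fun st hst => (Finset.mem_filter.1 hst).2.1)
    (p + 1 - {y | (fun x => F (x, y)) ≠ 0}.ncard) (fun s hs => by
      have hs0 : H s y ≠ 0 := by simpa [S] using hs
      have hunc := succ_le_ncard_support_add_ncard_support_dft
        (Function.ne_iff.2 ⟨y, hs0⟩ : H s ≠ 0)
      have hm : (support (H s)).ncard ≤ {y | (fun x => F (x, y)) ≠ 0}.ncard := by
        refine Set.ncard_le_ncard fun z hz h0 => hz ?_
        have h0' : (fun x => F (x, z)) = 0 := h0
        simp only [hH, h0', map_zero, Pi.zero_apply]
      have hfib : (support (ZMod.dft (H s))).ncard ≤ (U.filter fun st => st.1 = s).card := by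
        rw [← Set.ncard_image_of_injective _ (Prod.mk_right_injective s), ← Set.ncard_coe_finset]
        refine Set.ncard_le_ncard ?_
        rintro _ ⟨t, ht, rfl⟩
        simpa [U, hs] using ht
      omega)
  rw [mul_comm, ← Set.ncard_coe_finset S, ← Set.ncard_coe_finset U, Set.coe_toFinset] at hle
  exact hle.trans (Set.ncard_le_ncard hU)

theorem ncard_slices_add_ncard_support_slice_le {α β : Type*} [Finite α] [Finite β]
    (F : α × β → ℂ) {y : β} (hy : (fun x => F (x, y)) ≠ 0) :
    {y | (fun x => F (x, y)) ≠ 0}.ncard + (support fun x => F (x, y)).ncard ≤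
      (support F).ncard + 1 := by
  classical
  have : Nonempty α := ⟨(Function.ne_iff.1 hy).choose⟩
  choose! g hg using fun (z : β) (hz : (fun x => F (x, z)) ≠ 0) => Function.ne_iff.1 hz
  let S := (fun z => (g z, z)) '' ({y | (fun x => F (x, y)) ≠ 0} \ {y})
  let T := (fun x => (x, y)) '' (support fun x => F (x, y))
  have hS : S.ncard + 1 = {y | (fun x => F (x, y)) ≠ 0}.ncard := by
    rw [Set.ncard_image_of_injective _ fun z z' h => congrArg Prod.snd h]
    exact Set.ncard_sdiff_singleton_add_one hy
  have hT : T.ncard = (support fun x => F (x, y)).ncard :=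
    Set.ncard_image_of_injective _ fun z z' h => congrArg Prod.fst h
  have hd : Disjoint S T := by
    rw [Set.disjoint_left]
    rintro _ ⟨z, hz, rfl⟩ ⟨x, -, h⟩
    exact hz.2 (congrArg Prod.snd h).symm
  have hST : S ∪ T ⊆ support F := by
    rintro _ (⟨z, hz, rfl⟩ | ⟨x, hx, rfl⟩)
    · exact hg z hz.1
    · exact hx
  have := Set.ncard_le_ncard hST
  rw [Set.ncard_union_eq hd] at this
  omega

/-- For `G = ℤ/qℤ × ℤ/pℤ`, `q < p` primes and `1 ≤ k ≤ q`, every equality case for `(k, G)`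
is of the form `(x, y) ↦ f(x) δ_a(y)` with `|supp f| = k` and `|supp f̂| = q - k + 1`. -/
theorem equality_case_small_k (p q : ℕ) [Fact p.Prime] [Fact q.Prime] (hqp : q < p)
    (k : ℕ) (hk1 : 1 ≤ k) (hk2 : k ≤ q)
    (F : ZMod q × ZMod p → ℂ) (hF : IsEqualityCase (ZMod q × ZMod p) k F) :
    ∃ (a : ZMod p) (f : ZMod q → ℂ),
      (support f).ncard = k ∧ (support (zdft q f)).ncard = q - k + 1 ∧
      F = fun x => f x.1 * (if x.2 = a then 1 else 0) := by
  obtain ⟨hF0, hFk, hFt⟩ := hF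
  have hub := hFt.trans_le (theta_zmod_prod_le (p := p) hk1 hk2)
  obtain ⟨⟨x₀, a⟩, hxa⟩ := Function.ne_iff.1 hF0
  have ha : (fun x => F (x, a)) ≠ 0 := Function.ne_iff.2 ⟨x₀, hxa⟩
  have hslice := ncard_slices_add_ncard_support_slice_le F ha
  have hunc := succ_le_ncard_support_add_ncard_support_dft ha
  have hlow := (mul_le_ncard_support_dft_prod F a).trans hub
  set m := {y | (fun x => F (x, y)) ≠ 0}.ncard with hm
  have hm0 : 0 < m := (Set.ncard_pos).2 ⟨a, ha⟩
  have hpos : 0 < (support fun x => F (x, a)).ncard := (Set.ncard_pos).2 ⟨x₀, hxa⟩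
  have hm1 : m = 1 := by
    by_contra hne
    obtain ⟨s, hs⟩ := Nat.exists_eq_add_of_le hk2
    obtain ⟨n, hn⟩ := Nat.exists_eq_add_of_le (show 2 ≤ m by omega)
    obtain ⟨r, hr⟩ := Nat.exists_eq_add_of_le (show s + m + 1 ≤ p by omega)
    have h1 : s + m ≤ (support (ZMod.dft fun x => F (x, a))).ncard := by omega
    have h2 := (Nat.mul_le_mul_right (p + 1 - m) h1).trans hlow
    have h3 : p + 1 - m = s + 2 + r := by omega
    have h4 : q - k + 1 = s + 1 := by omega
    rw [h3, h4, hr, hn] at h2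
    nlinarith
  obtain ⟨b, hb⟩ := Set.ncard_eq_one.1 hm1
  have hab : a = b := by
    have : a ∈ {y | (fun x => F (x, y)) ≠ 0} := ha
    rwa [hb] at this
  have hFeq : F = fun x => F (x.1, a) * (if x.2 = a then 1 else 0) := by
    funext ⟨x, y⟩
    by_cases hy : y = a
    · simp [hy]
    · have : y ∉ {y | (fun x => F (x, y)) ≠ 0} := by
        rw [hb, ← hab]; exact hy
      have h0 : (fun x => F (x, y)) = 0 := by simpa using this
      simpa [hy] using congrFun h0 x
  have hsupp : (support fun x => F (x, a)).ncard = k := by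
    rw [← hFk, ← ncard_support_mul_indicator (fun x => F (x, a)) a, ← hFeq]
  refine ⟨a, fun x => F (x, a), hsupp, ?_, hFeq⟩
  rw [zdft_eq_dft]
  rw [hFeq, ncard_support_dft_mul_indicator (fun x => F (x, a)) a] at hub
  have := Nat.le_of_mul_le_mul_right hub (Fact.out : p.Prime).pos
  omega
end
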